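/- arXiv:math/9806078 — 6 statements merged into one kernel-verified Lean document; each statement's English description precedes it below -/
import Mathlib

section
/- Every proper abelian mapping admits an algebraic addition theorem: let ω₁,…,ω_{2n} ∈ ℂⁿ be vectors that are linearly independent over ℝ (regarding ℂⁿ as a real vector space of dimension 2n), and suppose each φ_k (k = 1,…,n) satisfies φ_k(u + ω_i) = φ_k(u) for every i = 1,…,2n and every u at which both sides are analytic. Then the mapping Φ = (φ₁,…,φ_n) admits an algebraic addition theorem: for each k = 1,…,n there is a polynomial G_k ∈ ℂ[λ, x₁,…,x_n, y₁,…,y_n] of degree ≥ 1 in λ such that G_k(φ_k(u+v); φ₁(u),…,φ_n(u), φ₁(v),…,φ_n(v)) = 0 whenever each φ_j is analytic at u and at v and φ_k is analytic at u+v. -/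
open MvPolynomial

/-- The partial derivative `∂f/∂u_p` of a function on ℂⁿ. -/
noncomputable def pd {n : ℕ} (f : (Fin n → ℂ) → ℂ) (p : Fin n) (u : Fin n → ℂ) : ℂ :=
  fderiv ℂ f u (Pi.single p 1)

/-- `f` is meromorphic on ℂⁿ: a quotient of two everywhere-analytic functions. -/
def Mero {n : ℕ} (f : (Fin n → ℂ) → ℂ) : Prop :=
  ∃ g h : (Fin n → ℂ) → ℂ, (∀ u, AnalyticAt ℂ g u) ∧ (∀ u, AnalyticAt ℂ h u) ∧
    (∃ u, h u ≠ 0) ∧ ∀ u, h u ≠ 0 → f u = g u / h u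

/-- The Jacobian determinant of the family `φ` is not identically zero. -/
def AnalyticallyIndep {n : ℕ} (φ : Fin n → (Fin n → ℂ) → ℂ) : Prop :=
  ∃ u : Fin n → ℂ, (∀ j, AnalyticAt ℂ (φ j) u) ∧
    Matrix.det (Matrix.of fun k p => pd (φ k) p u) ≠ 0

/-- `Φ = (φ₁,…,φ_n)` admits an algebraic addition theorem: for each `k` there is a
polynomial `G_k` in the variables `λ` (= `none`), `x_j` (= `some (inl j)`) and
`y_j` (= `some (inr j)`), of degree ≥ 1 in `λ`, with
`G_k(φ_k(u+v); φ(u), φ(v)) = 0` wherever all functions involved are analytic. -/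
def AdmitsAAT {n : ℕ} (φ : Fin n → (Fin n → ℂ) → ℂ) : Prop :=
  ∀ k : Fin n, ∃ G : MvPolynomial (Option (Fin n ⊕ Fin n)) ℂ,
    1 ≤ G.degreeOf none ∧
    ∀ u v : Fin n → ℂ, (∀ j, AnalyticAt ℂ (φ j) u) → (∀ j, AnalyticAt ℂ (φ j) v) →
      AnalyticAt ℂ (φ k) (u + v) →
      eval (fun i => i.elim (φ k (u + v)) (Sum.elim (fun j => φ j u) fun j => φ j v)) G = 0

/-- The valuation sending the variable `none` to `θ(u)` and `some j` to `φ_j(u)`. -/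
noncomputable def tval {n : ℕ} (θ : (Fin n → ℂ) → ℂ) (φ : Fin n → (Fin n → ℂ) → ℂ)
    (u : Fin n → ℂ) : Option (Fin n) → ℂ :=
  fun i => i.elim (θ u) fun j => φ j u

/-- `f` is a rational function on ℂⁿ. -/
def RatFn {n : ℕ} (f : (Fin n → ℂ) → ℂ) : Prop :=
  ∃ P Q : MvPolynomial (Fin n) ℂ, Q ≠ 0 ∧
    ∃ s : Set (Fin n → ℂ), IsOpen s ∧ s.Nonempty ∧
      ∀ u ∈ s, f u = eval u P / eval u Q

section AATCore
open Filter Topology Metric Asymptotics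

variable {E : Type*} [NormedAddCommGroup E] [NormedSpace ℂ E]

lemma aat_dense_ne {h : E → ℂ} (ha : ∀ u, AnalyticAt ℂ h u) (hne : ∃ u, h u ≠ 0) :
    Dense {u | h u ≠ 0} := by
  rw [← interior_eq_empty_iff_dense_compl.trans (Iff.of_eq (congrArg Dense (by ext; simp)) :
    Dense {u | h u = 0}ᶜ ↔ Dense {u | h u ≠ 0})]
  by_contra hc
  obtain ⟨z, hz⟩ := Set.nonempty_iff_ne_empty.mpr hc
  obtain ⟨u, hu⟩ := hne
  have h1 : h =ᶠ[𝓝 z] 0 := by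
    filter_upwards [mem_interior_iff_mem_nhds.mp hz] with y hy using hy
  have := AnalyticOnNhd.eqOn_zero_of_preconnected_of_eventuallyEq_zero
    (f := h) (U := Set.univ) (𝕜 := ℂ) (fun x _ => ha x) isPreconnected_univ (Set.mem_univ z) h1
  exact hu (this (Set.mem_univ u))

lemma aat_circle_pt {H : E → ℂ} (ha : ∀ u, AnalyticAt ℂ H u) (hne : ∃ u, H u ≠ 0) (x : E) :
    ∃ d : E, ‖d‖ ≤ 1 ∧ ∀ ζ : ℂ, ‖ζ‖ = 1 → H (x + ζ • d) ≠ 0 := by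
  obtain ⟨w, hw⟩ := hne
  set g : ℂ → ℂ := fun s => H (x + s • (w - x)) with hg
  have hga : ∀ s, AnalyticAt ℂ g s := by
    intro s
    have h1 : AnalyticAt ℂ (fun s : ℂ => x + s • (w - x)) s := by fun_prop
    exact (ha _).fun_comp h1
  have h2 : ∀ᶠ s in 𝓝[≠] (0 : ℂ), g s ≠ 0 := by
    rcases (hga 0).eventually_eq_zero_or_eventually_ne_zero with h | h
    · exfalso
      have := AnalyticOnNhd.eqOn_zero_of_preconnected_of_eventuallyEq_zero
        (f := g) (U := Set.univ) (𝕜 := ℂ) (fun x _ => hga x) isPreconnected_univ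
        (Set.mem_univ 0) h
      have h3 := this (Set.mem_univ 1)
      apply hw
      simpa [hg] using h3
    · exact h
  rw [eventually_nhdsWithin_iff, Metric.eventually_nhds_iff] at h2
  obtain ⟨ε, hε, h2⟩ := h2
  set r : ℝ := min (ε / 2) (1 / (‖w - x‖ + 1)) with hr
  have hr0 : 0 < r := by positivity
  refine ⟨(r : ℂ) • (w - x), ?_, ?_⟩
  · rw [norm_smul, Complex.norm_real, Real.norm_of_nonneg hr0.le]
    have : r ≤ 1 / (‖w - x‖ + 1) := min_le_right _ _
    rw [le_div_iff₀ (by positivity)] at this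
    nlinarith [norm_nonneg (w - x)]
  · intro ζ hζ
    have := @h2 (ζ * r) (by
      simp only [dist_zero_right, norm_mul, hζ, Complex.norm_real, Real.norm_of_nonneg hr0.le]
      have : r ≤ ε / 2 := min_le_left _ _
      linarith) (by
        simp only [Set.mem_compl_iff, Set.mem_singleton_iff, mul_eq_zero, not_or]
        exact ⟨fun h => by simp [h] at hζ, by exact_mod_cast hr0.ne'⟩)
    simpa [hg, mul_smul] using this

lemma aat_circle {H : E → ℂ} (ha : ∀ u, AnalyticAt ℂ H u) (hne : ∃ u, H u ≠ 0) {K : Set E}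
    (hK : IsCompact K) :
    ∃ δ > 0, ∀ x ∈ K, ∃ d : E, ‖d‖ ≤ 1 ∧ ∀ ζ : ℂ, ‖ζ‖ = 1 → δ ≤ ‖H (x + ζ • d)‖ := by
  have hc : Continuous H := continuous_iff_continuousAt.mpr fun x => (ha x).continuousAt
  refine hK.induction_on (p := fun K => ∃ δ > 0, ∀ x ∈ K, ∃ d : E, ‖d‖ ≤ 1 ∧
    ∀ ζ : ℂ, ‖ζ‖ = 1 → δ ≤ ‖H (x + ζ • d)‖) ?_ ?_ ?_ ?_
  · exact ⟨1, one_pos, by simp⟩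
  · intro s t hst ht
    obtain ⟨δ, h0, h⟩ := ht
    exact ⟨δ, h0, fun x hx => h x (hst hx)⟩
  · intro s t hs ht
    obtain ⟨δ, h0, h⟩ := hs
    obtain ⟨δ', h0', h'⟩ := ht
    refine ⟨min δ δ', lt_min h0 h0', ?_⟩
    rintro x (hx | hx)
    · obtain ⟨d, hd, h1⟩ := h x hx
      exact ⟨d, hd, fun ζ hζ => (min_le_left _ _).trans (h1 ζ hζ)⟩
    · obtain ⟨d, hd, h1⟩ := h' x hx
      exact ⟨d, hd, fun ζ hζ => (min_le_right _ _).trans (h1 ζ hζ)⟩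
  · intro x hx
    obtain ⟨d, hd, h1⟩ := aat_circle_pt ha hne x
    have hS : IsCompact (sphere (0 : ℂ) 1) := isCompact_sphere _ _
    obtain ⟨ζ₀, hζ₀, hmin⟩ := hS.exists_isMinOn ⟨1, by simp⟩
      (f := fun ζ => ‖H (x + ζ • d)‖) (by fun_prop)
    have hpos : 0 < ‖H (x + ζ₀ • d)‖ := norm_pos_iff.mpr (h1 _ (by simpa using hζ₀))
    set η := ‖H (x + ζ₀ • d)‖ with hη
    refine ⟨{y | ∀ ζ ∈ sphere (0 : ℂ) 1, η / 2 < ‖H (y + ζ • d)‖}, mem_nhdsWithin_of_mem_nhds ?_,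
      η / 2, by positivity, ?_⟩
    · refine hS.eventually_forall_of_forall_eventually (x₀ := x)
        (P := fun y ζ => η / 2 < ‖H (y + ζ • d)‖) ?_
      intro ζ hζ
      have : ContinuousAt (fun z : E × ℂ => ‖H (z.1 + z.2 • d)‖) (x, ζ) :=
        Continuous.continuousAt (by fun_prop)
      refine this.eventually (lt_mem_nhds ?_)
      have := hmin hζ
      simp only [Set.mem_ofPred_eq] at this
      change η / 2 < ‖H (x + ζ • d)‖
      linarith
    · intro y hy
      exact ⟨d, hd, fun ζ hζ => (hy ζ (by simpa using hζ)).le⟩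

lemma aat_maxmod {P : E → ℂ} (ha : ∀ u, AnalyticAt ℂ P u) (x d : E) :
    ∃ ζ : ℂ, ‖ζ‖ = 1 ∧ ‖P x‖ ≤ ‖P (x + ζ • d)‖ := by
  have hd : Differentiable ℂ (fun s : ℂ => P (x + s • d)) := by
    intro s
    have h1 : DifferentiableAt ℂ (fun s : ℂ => x + s • d) s := by fun_prop
    exact (ha _).differentiableAt.comp s h1
  obtain ⟨ζ, hζ, h⟩ := Complex.exists_mem_frontier_isMaxOn_norm (f := fun s : ℂ => P (x + s • d))
    (U := ball 0 1) isBounded_ball ⟨0, by simp⟩ hd.diffContOnCl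
  rw [frontier_ball _ one_ne_zero] at hζ
  refine ⟨ζ, by simpa using hζ, ?_⟩
  have := h (subset_closure (mem_ball_self one_pos))
  simpa using this

end AATCore
section AATCore2
open Filter Topology Metric Asymptotics

variable {E : Type*} [NormedAddCommGroup E] [NormedSpace ℂ E]

lemma aat_prod_ne {ι : Type*} (s : Finset ι) (f : ι → E → ℂ)
    (ha : ∀ i u, AnalyticAt ℂ (f i) u) (hne : ∀ i, ∃ u, f i u ≠ 0) :
    ∃ u, ∏ i ∈ s, f i u ≠ 0 := by
  classical
  induction s using Finset.induction_on with
  | empty => exact ⟨0, by simp⟩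
  | insert a s has ih =>
    have hc : Continuous (fun u => ∏ i ∈ s, f i u) :=
      continuous_finsetProd _ fun i _ => continuous_iff_continuousAt.mpr
        fun x => (ha i x).continuousAt
    obtain ⟨u, hu, hu'⟩ := (aat_dense_ne (ha a) (hne a)).inter_open_nonempty _
      (isOpen_ne_fun hc continuous_const) ih
    refine ⟨u, ?_⟩
    rw [Finset.prod_insert has]
    exact mul_ne_zero hu' hu

lemma aat_growth [ProperSpace E] {h : E → ℂ} (ha : ∀ u, AnalyticAt ℂ h u) (hne : ∃ u, h u ≠ 0)
    (Λ : Set E) (R : ℝ) (hR : ∀ x, ∃ l ∈ Λ, ‖x - l‖ < R) (R' : ℝ) :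
    ∃ C : ℝ, 0 ≤ C ∧ ∀ (t : ℕ) (P : E → ℂ), (∀ u, AnalyticAt ℂ P u) →
      (∀ x, ∀ l ∈ Λ, P (x + l) * h x ^ t = P x * h (x + l) ^ t) →
      ∀ M, (∀ x, ‖x‖ ≤ R → ‖P x‖ ≤ M) → ∀ x, ‖x‖ ≤ R' → ‖P x‖ ≤ C ^ t * M := by
  classical
  have hc : Continuous h := continuous_iff_continuousAt.mpr fun x => (ha x).continuousAt
  have hB : IsCompact (closedBall (0 : E) (R' + 1)) := isCompact_closedBall _ _
  obtain ⟨S', hS', hfin, hcov⟩ := hB.elim_finite_subcover_image (b := Λ) (c := fun l => ball l R)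
    (fun _ _ => isOpen_ball) (by
      intro x _
      obtain ⟨l, hl, hx⟩ := hR x
      simp only [Set.mem_iUnion]
      exact ⟨l, hl, by rwa [mem_ball, dist_eq_norm]⟩)
  set S := hfin.toFinset with hS
  have hsa : ∀ l u, AnalyticAt ℂ (fun y => h (y - l)) u := by
    intro l u
    have h1 : AnalyticAt ℂ (fun y : E => y - l) u := by fun_prop
    exact (ha _).fun_comp h1
  have hsne : ∀ l, ∃ u, h (u - l) ≠ 0 := by
    intro l
    obtain ⟨u, hu⟩ := hne
    exact ⟨u + l, by simpa using hu⟩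
  obtain ⟨δ, hδ, hcirc⟩ := aat_circle (H := fun y => ∏ l ∈ S, h (y - l))
    (fun u => Finset.analyticAt_fun_prod S fun l _ => hsa l u)
    (aat_prod_ne S (fun l y => h (y - l)) hsa hsne) (isCompact_closedBall (0 : E) R')
  obtain ⟨A, hA⟩ := hB.exists_bound_of_continuousOn
    (f := fun y => ∑ l ∈ S, ‖h y‖ * ∏ m ∈ S.erase l, ‖h (y - m)‖) (by fun_prop)
  refine ⟨|A| / δ, by positivity, ?_⟩
  intro t P hP hper M hM x hx
  obtain ⟨d, hd, hζ⟩ := hcirc x (by simpa using hx)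
  obtain ⟨ζ, h1, hPx⟩ := aat_maxmod hP x d
  have hH := hζ ζ h1
  set y := x + ζ • d with hy
  have hyB : y ∈ closedBall (0 : E) (R' + 1) := by
    rw [mem_closedBall, dist_zero_right]
    calc ‖y‖ ≤ ‖x‖ + ‖ζ • d‖ := norm_add_le _ _
      _ ≤ R' + 1 := by rw [norm_smul, h1, one_mul]; linarith
  have hyc := hcov hyB
  simp only [Set.mem_iUnion] at hyc
  obtain ⟨l, hl, hyl⟩ := hyc
  rw [mem_ball, dist_eq_norm] at hyl
  have hlS : l ∈ S := by simpa [hS] using hl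
  have hA1 : ‖h y‖ * ∏ m ∈ S.erase l, ‖h (y - m)‖ ≤ |A| := by
    have h2 := (le_abs_self _).trans ((hA y hyB).trans (le_abs_self A))
    refine le_trans ?_ h2
    exact Finset.single_le_sum (f := fun l => ‖h y‖ * ∏ m ∈ S.erase l, ‖h (y - m)‖)
      (fun i _ => by positivity) hlS
  have hp := hper (y - l) l (hS' hl)
  rw [sub_add_cancel] at hp
  have hp' : ‖P y‖ * ‖h (y - l)‖ ^ t = ‖P (y - l)‖ * ‖h y‖ ^ t := by
    simpa using congrArg norm hp
  have hM0 : ‖P (y - l)‖ ≤ M := hM _ hyl.le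
  have hprod : ‖∏ l ∈ S, h (y - l)‖ = ‖h (y - l)‖ * ∏ m ∈ S.erase l, ‖h (y - m)‖ := by
    rw [norm_prod, Finset.mul_prod_erase S (fun m => ‖h (y - m)‖) hlS]
  have key : ‖P y‖ * δ ^ t ≤ M * |A| ^ t := by
    calc ‖P y‖ * δ ^ t ≤ ‖P y‖ * ‖∏ l ∈ S, h (y - l)‖ ^ t := by gcongr
      _ = (‖P y‖ * ‖h (y - l)‖ ^ t) * (∏ m ∈ S.erase l, ‖h (y - m)‖) ^ t := by
          rw [hprod, mul_pow]; ring
      _ = ‖P (y - l)‖ * (‖h y‖ * ∏ m ∈ S.erase l, ‖h (y - m)‖) ^ t := by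
          rw [hp', mul_pow]; ring
      _ ≤ M * |A| ^ t := by
          have : 0 ≤ M := (norm_nonneg _).trans hM0
          gcongr
  refine hPx.trans ?_
  rw [div_pow, div_mul_eq_mul_div, le_div_iff₀ (by positivity)]
  linarith

lemma aat_jet {N : ℕ} (b : Module.Basis (Fin N) ℂ E) {f : E → ℂ} (hf : AnalyticAt ℂ f 0) (m : ℕ) :
    ∃ q : MvPolynomial (Fin N) ℂ, (∀ d ∈ q.support, ∀ i, d i < m) ∧
      (fun x => f x - eval (fun i => b.repr x i) q) =O[𝓝 0] fun x => ‖x‖ ^ m := by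
  obtain ⟨p, hp⟩ := hf
  refine ⟨∑ j ∈ Finset.range m, ∑ r : Fin j → Fin N, C (p j (fun i => b (r i))) * ∏ i, X (r i),
    ?_, ?_⟩
  · intro d hd i
    by_contra hcon
    push Not at hcon
    rw [mem_support_iff] at hd
    apply hd
    rw [coeff_sum]
    refine Finset.sum_eq_zero fun j hj => ?_
    rw [coeff_sum]
    refine Finset.sum_eq_zero fun r _ => ?_
    refine coeff_eq_zero_of_totalDegree_lt ?_
    have h1 : (C (p j (fun i => b (r i))) * ∏ i, X (r i) : MvPolynomial (Fin N) ℂ).totalDegree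
        ≤ j := by
      refine (totalDegree_mul _ _).trans ?_
      rw [totalDegree_C, zero_add]
      refine (totalDegree_finsetProd _ _).trans ?_
      simp
    have h2 : d i ≤ ∑ i ∈ d.support, d i := by
      by_cases hi : i ∈ d.support
      · exact Finset.single_le_sum (f := fun i => d i) (fun _ _ => Nat.zero_le _) hi
      · simp [Finsupp.notMem_support_iff.mp hi]
    have := Finset.mem_range.mp hj
    omega
  · have h := hp.isBigO_sub_partialSum_pow m
    refine h.congr_left fun x => ?_
    rw [zero_add, FormalMultilinearSeries.partialSum]
    congr 1
    simp only [map_sum, map_mul, eval_C, map_prod, eval_X]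
    refine Finset.sum_congr rfl fun j _ => ?_
    conv_lhs => rw [← b.sum_repr x]
    have := (p j).toMultilinearMap.map_sum (fun (_ : Fin j) (k : Fin N) => b.repr x k • b k)
    simp only [ContinuousMultilinearMap.coe_coe] at this
    rw [this]
    refine Finset.sum_congr rfl fun r _ => ?_
    rw [ContinuousMultilinearMap.map_smul_univ, smul_eq_mul, mul_comm]

lemma aat_jets {N : ℕ} (b : Module.Basis (Fin N) ℂ E) {A : Type*} [Fintype A] (f : A → E → ℂ)
    (hf : ∀ a, AnalyticAt ℂ (f a) 0) (m : ℕ) (hm : m ^ N < Fintype.card A) :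
    ∃ c : A → ℂ, c ≠ 0 ∧ (fun x => ∑ a, c a * f a x) =O[𝓝 0] fun x => ‖x‖ ^ m := by
  classical
  choose q hq hO using fun a => aat_jet b (hf a) m
  let T : (A → ℂ) →ₗ[ℂ] ((Fin N → Fin m) → ℂ) :=
    { toFun := fun c d => ∑ a, c a * coeff (Finsupp.equivFunOnFinite.symm fun i => (d i : ℕ)) (q a)
      map_add' := by
        intro c c'; ext d; simp [add_mul, Finset.sum_add_distrib]
      map_smul' := by
        intro c c'; ext d; simp [Finset.mul_sum, mul_assoc] }
  have hT : LinearMap.ker T ≠ ⊥ := by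
    apply LinearMap.ker_ne_bot_of_finrank_lt
    simpa using hm
  obtain ⟨c, hc, hc0⟩ := Submodule.exists_mem_ne_zero_of_ne_bot hT
  refine ⟨c, hc0, ?_⟩
  have hz : ∑ a, C (c a) * q a = 0 := by
    ext d
    rw [coeff_sum, coeff_zero]
    simp only [coeff_C_mul]
    by_cases hd : ∀ i, d i < m
    · have := congrFun (LinearMap.mem_ker.mp hc) (fun i => ⟨d i, hd i⟩)
      have h2 : (Finsupp.equivFunOnFinite.symm fun i => d i) = d := by ext; simp
      simpa [T, h2] using this
    · refine Finset.sum_eq_zero fun a _ => ?_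
      have : coeff d (q a) = 0 := by
        by_contra h
        exact hd (hq a d (mem_support_iff.mpr h))
      rw [this, mul_zero]
  have hsum : (fun x => ∑ a, c a * (f a x - eval (fun i => b.repr x i) (q a)))
      =O[𝓝 0] fun x => ‖x‖ ^ m :=
    IsBigO.fun_sum fun a _ => (hO a).const_mul_left _
  refine hsum.congr_left fun x => ?_
  have := congrArg (eval (fun i => b.repr x i)) hz
  simp only [map_sum, map_mul, eval_C, map_zero] at this
  simp only [mul_sub, Finset.sum_sub_distrib, this, sub_zero]

end AATCore2
section AATCore3
open Filter Topology Metric Asymptotics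

variable {E : Type*} [NormedAddCommGroup E] [NormedSpace ℂ E]

lemma aat_core [FiniteDimensional ℂ E] {ι : Type*} [Fintype ι]
    (hcard : Module.finrank ℂ E < Fintype.card ι) (g h : ι → E → ℂ)
    (hg : ∀ i u, AnalyticAt ℂ (g i) u) (hh : ∀ i u, AnalyticAt ℂ (h i) u)
    (hne : ∀ i, ∃ u, h i u ≠ 0) (Λ : Set E) (R : ℝ) (hR : ∀ x, ∃ l ∈ Λ, ‖x - l‖ < R)
    (hper : ∀ i x, ∀ l ∈ Λ, g i (x + l) * h i x = g i x * h i (x + l)) :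
    ∃ F : MvPolynomial ι ℂ, F ≠ 0 ∧
      ∀ x, (∀ i, h i x ≠ 0) → eval (fun i => g i x / h i x) F = 0 := by
  classical
  have : ProperSpace E := FiniteDimensional.proper ℂ E
  have hR0 : 0 < R := by
    obtain ⟨l, -, hl⟩ := hR 0
    exact (norm_nonneg _).trans_lt hl
  set N := Module.finrank ℂ E with hN
  let b : Module.Basis (Fin N) ℂ E := Module.finBasis ℂ E
  obtain ⟨C₁, hC0, hC⟩ := aat_growth (h := fun x => ∏ i, h i x)
    (fun u => Finset.analyticAt_fun_prod _ fun i _ => hh i u)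
    (aat_prod_ne Finset.univ h hh hne) Λ R hR (2 * R)
  obtain ⟨c', hc'⟩ := pow_unbounded_of_one_lt C₁ (one_lt_two)
  set c := c' + 1 with hc
  have hcC : C₁ < 2 ^ c := hc'.trans (by rw [hc]; exact pow_lt_pow_right₀ one_lt_two (by omega))
  set t := c ^ N with ht
  have ht0 : 0 < t := by positivity
  set m := c * t with hm
  have hm0 : 0 < m := by positivity
  have hcount : m ^ N < Fintype.card (ι → Fin (t + 1)) := by
    rw [Fintype.card_fun, Fintype.card_fin, hm, mul_pow, ← ht, ← pow_succ']
    calc t ^ (N + 1) < (t + 1) ^ (N + 1) := Nat.pow_lt_pow_left (by omega) (by omega)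
      _ ≤ _ := Nat.pow_le_pow_right (by omega) (by omega)
  have hfa : ∀ (a : ι → Fin (t + 1)) u,
      AnalyticAt ℂ (fun x => ∏ i, (g i x ^ (a i : ℕ) * h i x ^ (t - (a i : ℕ)))) u := by
    intro a u
    exact Finset.analyticAt_fun_prod _ fun i _ => ((hg i u).pow _).mul ((hh i u).pow _)
  obtain ⟨co, hco, hO⟩ := aat_jets b
    (fun (a : ι → Fin (t + 1)) x => ∏ i, (g i x ^ (a i : ℕ) * h i x ^ (t - (a i : ℕ))))
    (fun a => hfa a 0) m hcount
  set P : E → ℂ := fun x => ∑ a : ι → Fin (t + 1),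
    co a * ∏ i, (g i x ^ (a i : ℕ) * h i x ^ (t - (a i : ℕ))) with hP
  have hPa : ∀ u, AnalyticAt ℂ P u := fun u =>
    Finset.analyticAt_fun_sum _ fun a _ => analyticAt_const.mul (hfa a u)
  have hPc : Continuous P := continuous_iff_continuousAt.mpr fun x => (hPa x).continuousAt
  have hPper : ∀ x, ∀ l ∈ Λ, P (x + l) * (∏ i, h i x) ^ t = P x * (∏ i, h i (x + l)) ^ t := by
    intro x l hl
    simp only [hP, Finset.sum_mul, mul_assoc, ← Finset.prod_pow, ← Finset.prod_mul_distrib]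
    refine Finset.sum_congr rfl fun a _ => ?_
    congr 1
    refine Finset.prod_congr rfl fun i _ => ?_
    have hle : (a i : ℕ) ≤ t := Nat.lt_succ_iff.mp (a i).2
    obtain ⟨e, he⟩ := Nat.exists_eq_add_of_le hle
    have h1 : t - (a i : ℕ) = e := by omega
    rw [h1]
    have h2 : ∀ z : ℂ, z ^ t = z ^ (a i : ℕ) * z ^ e := fun z => by rw [← pow_add, ← he]
    rw [h2 (h i x), h2 (h i (x + l))]
    have := congrArg (fun z => z ^ (a i : ℕ)) (hper i x l hl)
    simp only [mul_pow] at this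
    linear_combination (h i (x + l)) ^ e * (h i x) ^ e * this
  obtain ⟨x₀, hx₀, hmax⟩ := (isCompact_closedBall (0 : E) R).exists_isMaxOn
    ⟨0, by simp [hR0.le]⟩ hPc.norm.continuousOn
  have hbig := hC t P hPa hPper ‖P x₀‖ (fun x hx => hmax (by simpa using hx))
  have hlit : P =o[𝓝 0] fun x => ‖x‖ ^ (m - 1) := by
    refine hO.trans_isLittleO ?_
    refine (IsLittleO.of_norm_left ?_)
    have : (fun x : E => ‖x‖ ^ m) = fun x => ‖x‖ * ‖x‖ ^ (m - 1) := by
      ext x; rw [← pow_succ']; congr 1; omega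
    simp only [norm_pow, norm_norm]
    rw [this]
    have h1 : (fun x : E => ‖x‖) =o[𝓝 0] fun _ => (1 : ℝ) := by
      rw [isLittleO_one_iff]
      exact tendsto_norm_zero
    simpa using h1.mul_isBigO (isBigO_refl (fun x : E => ‖x‖ ^ (m - 1)) (𝓝 0))
  have hP0 : P 0 = 0 := by
    have h2 : Tendsto (fun x : E => ‖x‖ ^ m) (𝓝 0) (𝓝 0) := by
      have : Continuous (fun x : E => ‖x‖ ^ m) := by fun_prop
      simpa [hm0.ne'] using this.tendsto 0
    exact tendsto_nhds_unique (hPc.tendsto 0) (hO.trans_tendsto h2)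
  have hsch : ∀ z, ‖z‖ ≤ R → ‖P z‖ ≤ C₁ ^ t * ‖P x₀‖ * (‖z‖ / (2 * R)) ^ (m - 1 + 1) := by
    intro z hz
    have := Complex.dist_le_mul_div_pow_of_mapsTo_ball_of_isLittleO (f := P) (c := 0) (z := z)
      (R₁ := 2 * R) (R₂ := C₁ ^ t * ‖P x₀‖) (n := m - 1)
      (fun x _ => (hPa x).differentiableAt.differentiableWithinAt)
      (by
        intro y hy
        rw [hP0]
        simp only [mem_ball, dist_zero_right] at hy
        simpa using hbig y hy.le)
      (by simpa [hP0] using hlit)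
      (by simp only [mem_ball, dist_zero_right]; linarith)
    simpa [hP0] using this
  have hzero : ‖P x₀‖ = 0 := by
    have h1 := hsch x₀ (by simpa using hx₀)
    have h2 : (‖x₀‖ / (2 * R)) ^ (m - 1 + 1) ≤ (1 / 2) ^ m := by
      rw [Nat.sub_add_cancel hm0]
      have : ‖x₀‖ / (2 * R) ≤ 1 / 2 := by
        rw [div_le_div_iff₀ (by positivity) (by norm_num)]
        have : ‖x₀‖ ≤ R := by simpa using hx₀
        linarith
      gcongr
    have h3 : ‖P x₀‖ ≤ C₁ ^ t * ‖P x₀‖ * (1 / 2) ^ m := h1.trans (by gcongr)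
    have h4 : C₁ ^ t * (1 / 2 : ℝ) ^ m < 1 := by
      rw [hm, pow_mul, ← mul_pow]
      apply pow_lt_one₀ (by positivity) _ ht0.ne'
      rw [one_div, inv_pow, ← div_eq_mul_inv, div_lt_one (by positivity)]
      exact hcC
    by_contra hne0
    have h5 : 0 < ‖P x₀‖ := lt_of_le_of_ne (norm_nonneg _) (Ne.symm hne0)
    nlinarith
  have hPz : ∀ x, P x = 0 := by
    have h1 : P =ᶠ[𝓝 0] 0 := by
      filter_upwards [closedBall_mem_nhds (0 : E) hR0] with y hy
      have := hmax hy
      simp only [Set.mem_ofPred_eq, hzero] at this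
      simpa using this
    intro x
    exact AnalyticOnNhd.eqOn_zero_of_preconnected_of_eventuallyEq_zero
      (f := P) (U := Set.univ) (𝕜 := ℂ) (fun x _ => hPa x) isPreconnected_univ
      (Set.mem_univ 0) h1 (Set.mem_univ x)
  let e : (ι → Fin (t + 1)) → (ι →₀ ℕ) := fun a => Finsupp.equivFunOnFinite.symm fun i => (a i : ℕ)
  have he : Function.Injective e := by
    intro a a' haa
    have := Finsupp.equivFunOnFinite.symm.injective haa
    funext i
    exact Fin.ext (congrFun this i)
  refine ⟨∑ a, monomial (e a) (co a), ?_, ?_⟩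
  · intro hF
    apply hco
    funext a
    have := congrArg (coeff (e a)) hF
    rw [coeff_sum, coeff_zero] at this
    simp only [coeff_monomial, he.eq_iff] at this
    simpa using this
  · intro x hx
    have hpx := hPz x
    have hprod : (∏ i, h i x ^ t) ≠ 0 := Finset.prod_ne_zero_iff.mpr fun i _ => pow_ne_zero _ (hx i)
    refine (mul_eq_zero.mp ?_).resolve_right hprod
    rw [← hpx, hP, map_sum, Finset.sum_mul]
    refine Finset.sum_congr rfl fun a _ => ?_
    rw [eval_monomial, Finsupp.prod_fintype _ _ (by simp), mul_assoc, ← Finset.prod_mul_distrib]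
    congr 1
    refine Finset.prod_congr rfl fun i _ => ?_
    have hle : (a i : ℕ) ≤ t := Nat.lt_succ_iff.mp (a i).2
    have : h i x ^ t = h i x ^ (a i : ℕ) * h i x ^ (t - (a i : ℕ)) := by
      rw [← pow_add]; congr 1; omega
    rw [this, div_pow]
    have := hx i
    simp only [e, Finsupp.equivFunOnFinite_symm_apply_apply]
    field_simp

lemma aat_dense_zero {X : Type*} [TopologicalSpace X] {W : X → ℂ} {T : Set X} (hT : Dense T)
    (hW : ∀ x ∈ T, W x = 0) {x : X} (hx : ContinuousAt W x) : W x = 0 := by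
  by_contra hne
  have := hx.eventually_ne hne
  obtain ⟨y, hy, hyT⟩ := mem_closure_iff_nhds.mp (hT x) _ this
  exact hy (hW y hyT)

lemma aat_per (g h : E → ℂ)
    (hg : ∀ u, AnalyticAt ℂ g u) (hh : ∀ u, AnalyticAt ℂ h u) (hne : ∃ u, h u ≠ 0)
    (s : Set E) (hs : ∀ l ∈ s, ∀ x, h x ≠ 0 → h (x + l) ≠ 0 → g (x + l) / h (x + l) = g x / h x) :
    ∀ l ∈ Submodule.span ℤ s, ∀ x, g (x + l) * h x = g x * h (x + l) := by
  have hgc : Continuous g := continuous_iff_continuousAt.mpr fun x => (hg x).continuousAt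
  have hhc : Continuous h := continuous_iff_continuousAt.mpr fun x => (hh x).continuousAt
  have hd := aat_dense_ne hh hne
  have hdl : ∀ l, Dense {x | h (x + l) ≠ 0} := by
    intro l
    have h1 : ∀ u, AnalyticAt ℂ (fun y => h (y + l)) u := by
      intro u
      have h1 : AnalyticAt ℂ (fun y : E => y + l) u := by fun_prop
      exact (hh _).fun_comp h1
    refine aat_dense_ne h1 ?_
    obtain ⟨u, hu⟩ := hne
    exact ⟨u - l, by simpa using hu⟩
  have ext0 : ∀ (l : E) (T : Set E), Dense T →
      (∀ x ∈ T, g (x + l) * h x = g x * h (x + l)) → ∀ x, g (x + l) * h x = g x * h (x + l) := by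
    intro l T hT h1 x
    have hc : Continuous (fun x => g (x + l) * h x - g x * h (x + l)) := by fun_prop
    exact sub_eq_zero.mp (aat_dense_zero hT (fun x hx => sub_eq_zero.mpr (h1 x hx)) hc.continuousAt)
  intro l hl
  induction hl using Submodule.span_induction with
  | mem l hl =>
    refine ext0 l _ (hd.inter_of_isOpen_left (hdl l) (isOpen_ne_fun hhc continuous_const)) ?_
    rintro x ⟨hx1, hx2⟩
    have hx1 : h x ≠ 0 := hx1
    have hx2 : h (x + l) ≠ 0 := hx2
    have := hs l hl x hx1 hx2
    field_simp at this
    linear_combination this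
  | zero => simp
  | add l l' _ _ h1 h2 =>
    refine ext0 (l + l') _ (hdl l) ?_
    intro x hx
    have hx : h (x + l) ≠ 0 := hx
    have e1 := h1 x
    have e2 := h2 (x + l)
    rw [add_assoc] at e2
    apply mul_right_cancel₀ hx
    linear_combination h x * e2 + h (x + (l + l')) * e1
  | smul z l _ h1 =>
    have hnat : ∀ k : ℕ, ∀ x, g (x + k • l) * h x = g x * h (x + k • l) := by
      intro k
      induction k with
      | zero => simp
      | succ k ih =>
        refine ext0 _ _ (hdl (k • l)) ?_
        intro x hx
        have hx : h (x + k • l) ≠ 0 := hx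
        have e1 := ih x
        have e2 := h1 (x + k • l)
        rw [add_assoc, ← succ_nsmul] at e2
        apply mul_right_cancel₀ hx
        linear_combination h x * e2 + h (x + (k + 1) • l) * e1
    intro x
    obtain ⟨k, rfl | rfl⟩ := z.eq_nat_or_neg
    · simpa using hnat k x
    · have := hnat k (x + (-(k : ℤ)) • l)
      simp only [neg_smul, natCast_zsmul, neg_add_cancel_right] at this ⊢
      linear_combination -this

end AATCore3
section AATFinal
open Filter Topology Metric

lemma aat_surj {n : ℕ} (φ : Fin n → (Fin n → ℂ) → ℂ) (u : Fin n → ℂ)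
    (ha : ∀ j, AnalyticAt ℂ (φ j) u)
    (hdet : Matrix.det (Matrix.of fun k p => pd (φ k) p u) ≠ 0) :
    map (fun w j => φ j w) (𝓝 u) = 𝓝 (fun j => φ j u) := by
  have hs : HasStrictFDerivAt (fun w j => φ j w)
      (ContinuousLinearMap.pi fun k => fderiv ℂ (φ k) u) u :=
    hasStrictFDerivAt_pi.mpr fun k => (ha k).hasStrictFDerivAt
  refine hs.map_nhds_eq_of_surj ?_
  rw [LinearMap.range_eq_top]
  intro y
  set M : Matrix (Fin n) (Fin n) ℂ := Matrix.of fun k p => pd (φ k) p u with hM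
  refine ⟨M⁻¹.mulVec y, ?_⟩
  have h1 : M.mulVec (M⁻¹.mulVec y) = y := by
    rw [Matrix.mulVec_mulVec, Matrix.mul_nonsing_inv _ (isUnit_iff_ne_zero.mpr hdet),
      Matrix.one_mulVec]
  set v := M⁻¹.mulVec y with hv
  rw [← h1]
  funext k
  have h2 := LinearMap.pi_apply_eq_sum_univ ((fderiv ℂ (φ k) u : (Fin n → ℂ) →L[ℂ] ℂ) :
    (Fin n → ℂ) →ₗ[ℂ] ℂ) v
  simp only [ContinuousLinearMap.coe_coe] at h2
  change fderiv ℂ (φ k) u v = _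
  rw [h2]
  simp only [Matrix.mulVec, dotProduct, hM, Matrix.of_apply, pd, smul_eq_mul]
  refine Finset.sum_congr rfl fun p _ => ?_
  rw [mul_comm]
  congr 2
  funext j
  simp [Pi.single_apply, eq_comm]

lemma aat_analytic_of_ne {n : ℕ} {f g h : (Fin n → ℂ) → ℂ}
    (hg : ∀ u, AnalyticAt ℂ g u) (hh : ∀ u, AnalyticAt ℂ h u)
    (hf : ∀ u, h u ≠ 0 → f u = g u / h u) {u : Fin n → ℂ} (hu : h u ≠ 0) : AnalyticAt ℂ f u := by
  refine ((hg u).div (hh u) hu).congr ?_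
  filter_upwards [(hh u).continuousAt.eventually_ne hu] with w hw
  exact (hf w hw).symm

end AATFinal

theorem proper_abelian_admits_aat {n : ℕ} (hn : 1 ≤ n)
    (φ : Fin n → (Fin n → ℂ) → ℂ)
    (hmero : ∀ k, Mero (φ k)) (hindep : AnalyticallyIndep φ)
    (ω : Fin (2 * n) → Fin n → ℂ)
    (hω : LinearIndependent ℝ ω)
    (hper : ∀ (k : Fin n) (i : Fin (2 * n)) (u : Fin n → ℂ),
      AnalyticAt ℂ (φ k) (u + ω i) → AnalyticAt ℂ (φ k) u → φ k (u + ω i) = φ k u) :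
    AdmitsAAT φ := by
  intro k
  choose g h hg hh hne hf using hmero
  -- the lattice
  have hfr : Fintype.card (Fin (2 * n)) = Module.finrank ℝ (Fin n → ℂ) := by
    rw [Module.finrank_pi_fintype]
    simp [mul_comm]
  have hne' : Nonempty (Fin (2 * n)) := ⟨⟨0, by omega⟩⟩
  let b : Module.Basis (Fin (2 * n)) ℝ (Fin n → ℂ) :=
    basisOfLinearIndependentOfCardEqFinrank hω hfr
  have hb : ⇑b = ω := coe_basisOfLinearIndependentOfCardEqFinrank hω hfr
  set L := Submodule.span ℤ (Set.range ω) with hL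
  set R : ℝ := ∑ i, ‖b i‖ + 1 with hRdef
  have hR : ∀ x : Fin n → ℂ, ∃ l ∈ L, ‖x - l‖ < R := by
    intro x
    refine ⟨ZSpan.floor b x, ?_, ?_⟩
    · have := (ZSpan.floor b x).2
      have hLb : L = Submodule.span ℤ (Set.range b) := by rw [hL, hb]
      exact hLb.ge this
    · have := ZSpan.norm_fract_le (K := ℝ) b x
      rw [ZSpan.fract_apply] at this
      linarith
  have hP : ∀ j, ∀ l ∈ L, ∀ x, g j (x + l) * h j x = g j x * h j (x + l) := by
    intro j
    refine aat_per (g j) (h j) (hg j) (hh j) (hne j) _ ?_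
    rintro _ ⟨i, rfl⟩ x h1 h2
    rw [← hf j _ h1, ← hf j _ h2]
    exact hper j i x (aat_analytic_of_ne (hg j) (hh j) (hf j) h2)
      (aat_analytic_of_ne (hg j) (hh j) (hf j) h1)
  -- pulled back functions
  let pr : Option (Fin n ⊕ Fin n) → ((Fin n → ℂ) × (Fin n → ℂ)) →L[ℂ] (Fin n → ℂ) := fun i =>
    i.elim (ContinuousLinearMap.fst ℂ _ _ + ContinuousLinearMap.snd ℂ _ _)
      (Sum.elim (fun _ => ContinuousLinearMap.fst ℂ _ _) fun _ => ContinuousLinearMap.snd ℂ _ _)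
  let ix : Option (Fin n ⊕ Fin n) → Fin n := fun i => i.elim k (Sum.elim id id)
  have hpra : ∀ (f : (Fin n → ℂ) → ℂ), (∀ u, AnalyticAt ℂ f u) → ∀ i z,
      AnalyticAt ℂ (fun z => f (pr i z)) z := by
    intro f hfa i z
    exact (hfa _).fun_comp ((pr i).analyticAt z)
  have hprs : ∀ i, Function.Surjective (pr i) := by
    rintro (_ | _ | _) w
    · exact ⟨(w, 0), by simp [pr]⟩
    · exact ⟨(w, 0), by simp [pr]⟩
    · exact ⟨(0, w), by simp [pr]⟩
  have hne2 : ∀ i, ∃ z, h (ix i) (pr i z) ≠ 0 := by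
    intro i
    obtain ⟨u, hu⟩ := hne (ix i)
    obtain ⟨z, rfl⟩ := hprs i u
    exact ⟨z, hu⟩
  have hprL : ∀ i, ∀ z : (Fin n → ℂ) × (Fin n → ℂ), z.1 ∈ L ∧ z.2 ∈ L → pr i z ∈ L := by
    rintro (_ | _ | _) z ⟨h1, h2⟩
    · exact L.add_mem h1 h2
    · exact h1
    · exact h2
  obtain ⟨G, hG0, hG⟩ := aat_core (E := (Fin n → ℂ) × (Fin n → ℂ))
    (ι := Option (Fin n ⊕ Fin n)) (by simp)
    (fun i z => g (ix i) (pr i z)) (fun i z => h (ix i) (pr i z))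
    (fun i z => hpra _ (hg _) i z) (fun i z => hpra _ (hh _) i z) hne2
    {z | z.1 ∈ L ∧ z.2 ∈ L} R
    (by
      intro z
      obtain ⟨l, hl, h1⟩ := hR z.1
      obtain ⟨l', hl', h2⟩ := hR z.2
      exact ⟨(l, l'), ⟨hl, hl'⟩, by
        rw [Prod.norm_def]; exact max_lt h1 h2⟩)
    (by
      intro i z l hl
      simp only [map_add]
      exact hP (ix i) _ (hprL i l hl) _)
  -- the dense set of good points
  have hT : Dense {z : (Fin n → ℂ) × (Fin n → ℂ) | ∏ i, h (ix i) (pr i z) ≠ 0} :=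
    aat_dense_ne (fun z => Finset.analyticAt_fun_prod _ fun i _ => hpra _ (hh _) i z)
      (aat_prod_ne Finset.univ (fun i z => h (ix i) (pr i z)) (fun i z => hpra _ (hh _) i z) hne2)
  have hGT : ∀ z ∈ {z : (Fin n → ℂ) × (Fin n → ℂ) | ∏ i, h (ix i) (pr i z) ≠ 0},
      eval (fun i => φ (ix i) (pr i z)) G = 0 := by
    intro z hz
    have hz' : ∀ i, h (ix i) (pr i z) ≠ 0 := fun i => Finset.prod_ne_zero_iff.mp hz i (by simp)
    rw [← hG z hz']
    congr 2
    funext i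
    exact hf _ _ (hz' i)
  refine ⟨G, ?_, ?_⟩
  · by_contra hdeg
    have hdeg0 : G.degreeOf none = 0 := by omega
    have hvars : ((G.vars : Finset _) : Set (Option (Fin n ⊕ Fin n))) ⊆ Set.range some := by
      rintro (_ | i) hi
      · exfalso
        rw [degreeOf_def, Multiset.count_eq_zero] at hdeg0
        apply hdeg0
        have : none ∈ G.vars := hi
        rw [vars_def] at this
        simpa using this
      · exact ⟨i, rfl⟩
    obtain ⟨G', rfl⟩ := exists_rename_eq_of_vars_subset_range G some
      (Option.some_injective _) hvars
    obtain ⟨u₀, hu₀, hdet⟩ := hindep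
    have hU : {u | ∀ j, AnalyticAt ℂ (φ j) u} ∈ nhds u₀ :=
      Filter.eventually_all.mpr fun j => (hu₀ j).eventually_analyticAt
    have himg : (fun w j => φ j w) '' {u | ∀ j, AnalyticAt ℂ (φ j) u} ∈ nhds (fun j => φ j u₀) := by
      rw [← aat_surj φ u₀ hu₀ hdet]
      exact Filter.image_mem_map hU
    obtain ⟨ε, hε, hball⟩ := Metric.mem_nhds_iff.mp himg
    apply hG0
    have : G' = 0 := by
      refine funext_set (fun i => Metric.ball (Sum.elim (fun j => φ j u₀) (fun j => φ j u₀) i) ε) ?_ ?_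
      · intro i
        exact infinite_of_mem_nhds _ (Metric.ball_mem_nhds _ hε)
      · intro x hx
        rw [map_zero]
        obtain ⟨u, hu, hux⟩ := hball (show (fun j => x (Sum.inl j)) ∈ _ from by
          rw [Metric.mem_ball, dist_pi_lt_iff hε]
          exact fun j => hx (Sum.inl j) trivial)
        obtain ⟨v, hv, hvx⟩ := hball (show (fun j => x (Sum.inr j)) ∈ _ from by
          rw [Metric.mem_ball, dist_pi_lt_iff hε]
          exact fun j => hx (Sum.inr j) trivial)
        have hz := aat_dense_zero (W := fun z => eval (fun i => φ (ix (some i)) (pr (some i) z)) G')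
          hT (x := (u, v)) (by
            intro z hz
            have := hGT z hz
            rw [eval_rename] at this
            exact this) (by
            refine (MvPolynomial.continuous_eval G').continuousAt.comp (continuousAt_pi.mpr ?_)
            rintro (j | j)
            · exact ContinuousAt.comp (g := φ j) (f := Prod.fst) (hu j).continuousAt
                continuousAt_fst
            · exact ContinuousAt.comp (g := φ j) (f := Prod.snd) (hv j).continuousAt
                continuousAt_snd)
        rw [← hz]
        congr 2
        funext i
        rcases i with j | j
        · exact (congrFun hux j).symm
        · exact (congrFun hvx j).symm
    rw [this, map_zero]
  · intro u v hu hv huv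
    have hz := aat_dense_zero (W := fun z => eval (fun i => φ (ix i) (pr i z)) G)
      hT (x := (u, v)) hGT (by
        refine (MvPolynomial.continuous_eval G).continuousAt.comp (continuousAt_pi.mpr ?_)
        rintro (_ | j | j)
        · exact ContinuousAt.comp (g := φ k) (f := fun z : (Fin n → ℂ) × (Fin n → ℂ) => z.1 + z.2)
            huv.continuousAt (by fun_prop)
        · exact ContinuousAt.comp (g := φ j) (f := Prod.fst) (hu j).continuousAt
            continuousAt_fst
        · exact ContinuousAt.comp (g := φ j) (f := Prod.snd) (hv j).continuousAt
            continuousAt_snd)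
    rw [← hz]
    congr 2
    funext i
    rcases i with _ | j | j <;> rfl
end

section
/- Picard's 'tiny' theorem: let a ∈ ℂ, r > 0, and let f be analytic on the punctured disc {u ∈ ℂ : 0 < |u − a| < r} with an essential singularity at a (i.e., f is not meromorphic at a). Then for every c ∈ ℂ and every h > 0 there exists c' ∈ ℂ with |c' − c| < h such that the set {u : 0 < |u − a| < r and f(u) = c'} is infinite and has a as an accumulation point. -/
open MvPolynomial

lemma punctured_preconnected (a : ℂ) (r : ℝ) (hr : 0 < r) :
    IsPreconnected {u : ℂ | 0 < ‖u - a‖ ∧ ‖u - a‖ < r} := by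
  have h1 : IsPreconnected {w : ℂ | w.re < Real.log r} :=
    (convex_halfSpace_re_lt (Real.log r)).isPreconnected
  have h2 := h1.image (fun w => a + Complex.exp w) (by fun_prop)
  convert h2 using 1
  ext u
  simp only [Set.mem_ofPred_eq, Set.mem_image]
  constructor
  · rintro ⟨h0, h1⟩
    have hne : u - a ≠ 0 := norm_pos_iff.1 h0
    refine ⟨Complex.log (u - a), ?_, ?_⟩
    · rw [Complex.log_re]
      exact Real.log_lt_log h0 h1
    · rw [Complex.exp_log hne]; ring
  · rintro ⟨w, hw, rfl⟩
    rw [add_sub_cancel_left, Complex.norm_exp]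
    exact ⟨Real.exp_pos _, (Real.lt_log_iff_exp_lt hr).1 hw⟩

lemma casorati_weierstrass (a : ℂ) (ρ : ℝ) (hρ : 0 < ρ) (f : ℂ → ℂ)
    (hf : ∀ u : ℂ, 0 < ‖u - a‖ → ‖u - a‖ < ρ → AnalyticAt ℂ f u)
    (hm : ¬ MeromorphicAt f a) (c : ℂ) (h : ℝ) (hh : 0 < h) :
    ∃ u : ℂ, 0 < ‖u - a‖ ∧ ‖u - a‖ < ρ ∧ ‖f u - c‖ < h := by
  by_contra! hcon
  apply hm
  have hs : Metric.ball a ρ ∈ nhds a := Metric.ball_mem_nhds a hρ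
  have hmem : ∀ u ∈ Metric.ball a ρ \ {a}, 0 < ‖u - a‖ ∧ ‖u - a‖ < ρ := by
    rintro u ⟨h1, h2⟩
    exact ⟨norm_pos_iff.2 (sub_ne_zero.2 h2), by simpa [dist_eq_norm] using h1⟩
  have hd := Complex.differentiableOn_update_limUnder_of_bddAbove
    (f := fun u => (f u - c)⁻¹) hs ?_ ?_
  · have han : AnalyticAt ℂ _ a := hd.analyticAt hs
    have h1 := han.meromorphicAt
    rw [MeromorphicAt.update_iff] at h1
    have h2 := h1.inv.add (MeromorphicAt.const c a)
    refine h2.congr (Filter.Eventually.of_forall fun u => ?_)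
    simp
  · intro u hu
    obtain ⟨h0, h1⟩ := hmem u hu
    have h2 : f u - c ≠ 0 := norm_pos_iff.1 (hh.trans_le (hcon u h0 h1))
    exact (((hf u h0 h1).differentiableAt.sub_const c).inv h2).differentiableWithinAt
  · refine ⟨h⁻¹, ?_⟩
    rintro _ ⟨u, hu, rfl⟩
    obtain ⟨h0, h1⟩ := hmem u hu
    simp only [Function.comp, norm_inv]
    exact inv_anti₀ hh (hcon u h0 h1)

theorem picard_tiny (a : ℂ) (r : ℝ) (hr : 0 < r) (f : ℂ → ℂ)
    (hf : ∀ u : ℂ, 0 < ‖u - a‖ → ‖u - a‖ < r → AnalyticAt ℂ f u)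
    (hess : ¬ ∃ (m : ℕ) (g : ℂ → ℂ), AnalyticAt ℂ g a ∧
      ∀ u : ℂ, 0 < ‖u - a‖ → ‖u - a‖ < r → (u - a) ^ m * f u = g u) :
    ∀ (c : ℂ) (h : ℝ), 0 < h → ∃ c' : ℂ, ‖c' - c‖ < h ∧
      {u : ℂ | 0 < ‖u - a‖ ∧ ‖u - a‖ < r ∧ f u = c'}.Infinite ∧
      ∀ ε : ℝ, 0 < ε → ∃ u : ℂ, 0 < ‖u - a‖ ∧ ‖u - a‖ < r ∧ f u = c' ∧ ‖u - a‖ < ε := by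
  intro c h hh
  have hm : ¬ MeromorphicAt f a := by
    rintro ⟨m, hm⟩
    exact hess ⟨m, _, hm, fun u _ _ => rfl⟩
  have hopen := (AnalyticOnNhd.is_constant_or_isOpen (g := f)
    (U := {u : ℂ | 0 < ‖u - a‖ ∧ ‖u - a‖ < r}) (fun u hu => hf u hu.1 hu.2)
    (punctured_preconnected a r hr)).resolve_left (by
      rintro ⟨w, hw⟩
      exact hess ⟨0, fun _ => w, analyticAt_const, fun u h0 h1 => by simpa using hw u ⟨h0, h1⟩⟩)
  set ρ : ℕ → ℝ := fun n => min r (1 / ((n : ℝ) + 1)) with hρ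
  have hρpos : ∀ n, 0 < ρ n := fun n => lt_min hr (by positivity)
  have hD := dense_iInter_of_isOpen_nat
    (f := fun n => f '' {u : ℂ | 0 < ‖u - a‖ ∧ ‖u - a‖ < ρ n}) ?_ ?_
  · obtain ⟨c', hc'1, hc'2⟩ := Metric.dense_iff.1 hD c h hh
    rw [Set.mem_iInter] at hc'2
    have hacc : ∀ ε : ℝ, 0 < ε →
        ∃ u : ℂ, 0 < ‖u - a‖ ∧ ‖u - a‖ < r ∧ f u = c' ∧ ‖u - a‖ < ε := by
      intro ε hε
      obtain ⟨n, hn⟩ := exists_nat_one_div_lt hε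
      obtain ⟨u, ⟨h0, h1⟩, h2⟩ := hc'2 n
      exact ⟨u, h0, h1.trans_le (min_le_left _ _), h2, (h1.trans_le (min_le_right _ _)).trans hn⟩
    refine ⟨c', by simpa [dist_eq_norm] using hc'1, ?_, hacc⟩
    intro hfin
    obtain ⟨u₁, h0, h1, h2, -⟩ := hacc 1 one_pos
    obtain ⟨v, hv, hmin⟩ := Set.exists_min_image _ (fun u => ‖u - a‖) hfin ⟨u₁, h0, h1, h2⟩
    obtain ⟨u, k0, k1, k2, k3⟩ := hacc ‖v - a‖ hv.1
    exact absurd (hmin u ⟨k0, k1, k2⟩) (not_le.2 k3)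
  · intro n
    refine hopen _ (fun u hu => ⟨hu.1, hu.2.trans_le (min_le_left _ _)⟩) ?_
    have hc : Continuous fun u : ℂ => ‖u - a‖ := by fun_prop
    exact (isOpen_lt continuous_const hc).inter (isOpen_lt hc continuous_const)
  · intro n
    refine Metric.dense_iff.2 fun d δ hδ => ?_
    obtain ⟨u, h0, h1, h2⟩ := casorati_weierstrass a (ρ n) (hρpos n) f
      (fun u h0 h1 => hf u h0 (h1.trans_le (min_le_left _ _))) hm d δ hδ
    exact ⟨f u, by simpa [dist_eq_norm] using h2, u, ⟨h0, h1⟩, rfl⟩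
end

section
/- Suppose the meromorphic mapping Φ = (φ₁,…,φ_n) admits an algebraic addition theorem. Then all partial derivatives of the φ_k of order two and higher are rational functions of the n functions φ₁,…,φ_n and their n² first-order partial derivatives: for every k ∈ {1,…,n} and every multi-index m with |m| ≥ 2 there exist polynomials A, B in the n + n² variables x₁,…,x_n and z_{iq} (i, q = 1,…,n), with B(φ₁(u),…,φ_n(u), (∂φ_i/∂u_q(u))_{i,q}) not identically zero, such that ∂^m φ_k(u) = A(φ₁(u),…,φ_n(u), (∂φ_i/∂u_q(u))_{i,q}) / B(φ₁(u),…,φ_n(u), (∂φ_i/∂u_q(u))_{i,q}) for every u at which all these functions are analytic and the denominator is nonzero. -/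
open MvPolynomial

/-- Iterated partial derivatives along a list of coordinate directions. -/
noncomputable def pdIter {n : ℕ} (f : (Fin n → ℂ) → ℂ) : List (Fin n) → ((Fin n → ℂ) → ℂ)
  | [] => f
  | p :: ps => pd (pdIter f ps) p


namespace AATAux

section Alg

variable {k M : Type*} [Field k] [Field M] [Algebra k M]

theorem isAlg_adjoin_iff (s : Set M) (y : M) :
    IsAlgebraic (IntermediateField.adjoin k s) y ↔ IsAlgebraic (Algebra.adjoin k s) y := by
  open scoped IntermediateField.algebraAdjoinAdjoin in
  have := IsFractionRing.isAlgebraic_iff (Algebra.adjoin k s) (IntermediateField.adjoin k s) M (x := y)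
  exact this.symm

theorem exchange {ι : Type*} [Finite ι] (x w : ι → M) (hw : AlgebraicIndependent k w)
    (hwx : ∀ i, IsAlgebraic (IntermediateField.adjoin k (Set.range x)) (w i)) (y : M)
    (hy : IsAlgebraic (IntermediateField.adjoin k (Set.range x)) y) :
    IsAlgebraic (IntermediateField.adjoin k (Set.range w)) y := by
  rw [isAlg_adjoin_iff] at hy ⊢
  simp_rw [isAlg_adjoin_iff] at hwx
  have hcl : ∀ (s : Set M) (z : M), z ∈ (AlgebraicIndependent.matroid k M).closure s ↔
      IsAlgebraic (Algebra.adjoin k s) z := by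
    intro s z
    rw [AlgebraicIndependent.matroid_closure_eq]
    rfl
  rw [← hcl] at hy ⊢
  have hind : (AlgebraicIndependent.matroid k M).Indep (Set.range w) :=
    AlgebraicIndependent.matroid_indep_iff.mpr hw.to_subtype_range
  have hsub : Set.range w ⊆ (AlgebraicIndependent.matroid k M).closure (Set.range x) := by
    rintro _ ⟨i, rfl⟩
    exact (hcl _ _).2 (hwx i)
  have hfin : (AlgebraicIndependent.matroid k M).IsRkFinite (Set.range w) :=
    Matroid.isRkFinite_of_finite _ (Set.finite_range w)
  have := hfin.closure_eq_closure_of_subset_of_eRk_ge_eRk hsub (by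
    rw [Matroid.eRk_closure_eq, hind.eRk_eq_encard]
    refine (Matroid.eRk_le_encard _ _).trans ?_
    rw [← Set.image_univ, ← Set.image_univ, hw.injective.encard_image]
    exact Set.encard_image_le _ _)
  rw [this, Matroid.closure_closure]
  exact hy

theorem chain {A : Type*} [CommRing A] [Algebra k A] {σ : Type*} [Fintype σ]
    (D : Derivation k A A) (m : σ → A) (P : MvPolynomial σ k) :
    D (aeval m P) = ∑ i, aeval m (pderiv i P) * D (m i) := by
  classical
  induction P using MvPolynomial.induction_on with
  | C a => simp [← algebraMap_eq]
  | add p q hp hq => simp [hp, hq, add_mul, Finset.sum_add_distrib]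
  | mul_X p i hp =>
    simp only [map_mul, aeval_X, Derivation.leibniz, hp, smul_eq_mul, pderiv_X, map_add,
      add_mul, Finset.sum_add_distrib, Finset.mul_sum]
    congr 1
    · rw [Finset.sum_eq_single i] <;> simp +contextual
    · refine Finset.sum_congr rfl fun j _ => by ring

theorem isAlg_of_rel [CharZero k] {σ : Type*} [Fintype σ] (K : IntermediateField k M) (z : Option σ → M)
    (hz : ∀ i, z (some i) ∈ K) (G : MvPolynomial (Option σ) k) (h0 : aeval z G = 0)
    (h1 : aeval z (pderiv none G) ≠ 0) : IsAlgebraic K (z none) := by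
  let c : Option σ → Polynomial K := fun i => i.elim Polynomial.X
    (fun j => Polynomial.C ⟨z (some j), hz j⟩)
  have key : ∀ P : MvPolynomial (Option σ) k, Polynomial.aeval (z none) (aeval c P) = aeval z P := by
    intro P
    induction P using MvPolynomial.induction_on with
    | C a => 
      simp only [← algebraMap_eq, AlgHom.commutes]
      rw [IsScalarTower.algebraMap_apply k K (Polynomial K), ← Polynomial.C_eq_algebraMap,
        Polynomial.aeval_C, ← IsScalarTower.algebraMap_apply]
    | add p q hp hq => simp [hp, hq]
    | mul_X p i hp =>
      rw [map_mul, map_mul, hp, map_mul]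
      congr 1
      cases i <;> simp [c]
  refine ⟨aeval c G, fun h => h1 ?_, (key G).trans h0⟩
  have := chain ((Polynomial.derivative' (R := K)).restrictScalars k) c G
  rw [h, map_zero, Fintype.sum_option] at this
  simp [c] at this
  rw [← key, ← this, map_zero]

theorem exists_min {σ : Type*} [CharZero k] (z : Option σ → M)
    (hz : AlgebraicIndependent k (fun i => z (some i))) (G : MvPolynomial (Option σ) k)
    (hG : G ≠ 0) (h0 : aeval z G = 0) :
    ∃ G' : MvPolynomial (Option σ) k, aeval z G' = 0 ∧ aeval z (pderiv none G') ≠ 0 := by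
  induction hd : G.degreeOf none using Nat.strong_induction_on generalizing G with
  | _ d ih =>
  by_cases h1 : aeval z (pderiv none G) = 0
  · by_cases hd0 : d = 0
    · exfalso
      have hv : none ∉ G.vars := by
        intro hmem
        rw [hd0] at hd
        obtain ⟨m, hm, hm'⟩ := (mem_vars_iff_mem_support _).1 hmem
        have := monomial_le_degreeOf none hm
        simp at hm'
        omega
      obtain ⟨G', rfl⟩ := exists_rename_eq_of_vars_subset_range G some (Option.some_injective _) (by
        intro i hi
        cases i with
        | none => exact absurd hi hv
        | some j => exact ⟨j, rfl⟩)
      rw [aeval_rename] at h0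
      have : G' = 0 := hz (by rw [map_zero]; exact h0)
      simp [this] at hG
    · have hne : pderiv none G ≠ 0 := by
        obtain ⟨m, hm, hm'⟩ : ∃ m ∈ G.support, m none = d := by
          rw [degreeOf_eq_sup] at hd
          obtain ⟨m, hm, h⟩ := Finset.exists_mem_eq_sup G.support (support_nonempty.2 hG) (fun m => m none)
          exact ⟨m, hm, by rw [← hd, h]⟩
        intro h
        have h2 := coeff_pderiv (i := none) G (m - Finsupp.single none 1)
        rw [h, coeff_zero, tsub_add_cancel_of_le] at h2
        · rw [mem_support_iff] at hm
          rcases mul_eq_zero.1 h2.symm with h3 | h3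
          · exact hm h3
          · norm_cast at h3
        · simp; omega
      refine ih _ ?_ (pderiv none G) hne h1 rfl
      rw [degreeOf_lt_iff (Nat.pos_of_ne_zero hd0)]
      intro m hm
      rw [mem_support_iff, coeff_pderiv] at hm
      have := monomial_le_degreeOf none (mem_support_iff.2 (left_ne_zero_of_mul hm))
      simp at this
      omega
  · exact ⟨G, h0, h1⟩

/-- derivation on the fraction field -/
theorem exists_deriv {R : Type*} [CommRing R] [IsDomain R] [Algebra k R] (d : Derivation k R R) :
    ∃ D : Derivation k (FractionRing R) (FractionRing R), ∀ r, D (algebraMap R _ r) = algebraMap R _ (d r) := by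
  let F := FractionRing R
  let f : R →+* TrivSqZeroExt F F :=
    { toFun := fun r => TrivSqZeroExt.inl (algebraMap R F r) + TrivSqZeroExt.inr (algebraMap R F (d r))
      map_one' := by ext <;> simp
      map_zero' := by ext <;> simp
      map_add' := fun a b => by ext <;> simp <;> ring
      map_mul' := fun a b => by
        ext
        · simp
          ring
        · simp
          ring }
  have hf1 : ∀ r, (f r).fst = algebraMap R F r := fun r => by simp [f]
  have hf2 : ∀ r, (f r).snd = algebraMap R F (d r) := fun r => by simp [f]
  have hu : ∀ y : nonZeroDivisors R, IsUnit (f y) := by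
    intro y
    rw [TrivSqZeroExt.isUnit_iff_isUnit_fst, hf1]
    exact IsLocalization.map_units F y
  let g : F →+* TrivSqZeroExt F F := IsLocalization.lift hu
  have hg : ∀ r, g (algebraMap R F r) = f r := fun r => IsLocalization.lift_eq hu r
  have hfst : ∀ x, (g x).fst = x := by
    have : (TrivSqZeroExt.fstHom F F F).toRingHom.comp g = RingHom.id F := by
      apply IsLocalization.ringHom_ext (nonZeroDivisors R)
      ext r
      simp [hg, hf1]
    intro x
    exact congrArg (fun h => h x) this
  have halg : ∀ (c : k), algebraMap k F c = algebraMap R F (algebraMap k R c) := fun c =>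
    IsScalarTower.algebraMap_apply k R F c
  have hmul : ∀ a b : F, (g (a * b)).snd = a • (g b).snd + b • (g a).snd := by
    intro a b
    rw [map_mul, TrivSqZeroExt.snd_mul, hfst, hfst]
    simp [mul_comm]
  refine ⟨Derivation.mk' { toFun := fun x => (g x).snd, map_add' := fun a b => by simp, map_smul' := fun c a => ?_ } hmul, fun r => ?_⟩
  · rw [Algebra.smul_def, hmul, halg, hg]
    rw [hf2, Derivation.map_algebraMap, map_zero, smul_zero, add_zero, smul_eq_mul, RingHom.id_apply,
      Algebra.smul_def, halg]
  · change (g (algebraMap R F r)).snd = _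
    rw [hg, hf2]

theorem deriv_closed [CharZero k] {ι : Type*} [Finite ι] (D : Derivation k M M) (w : ι → M) (F : IntermediateField k M)
    (hw : ∀ i, w i ∈ F) (hDw : ∀ i, D (w i) ∈ F) (a : M) (ha : a ∈ F)
    (hal : IsAlgebraic (IntermediateField.adjoin k (Set.range w)) a) : D a ∈ F := by
  have := Fintype.ofFinite ι
  have hpoly : ∀ P : MvPolynomial ι k, aeval w P ∈ F := by
    intro P
    induction P using MvPolynomial.induction_on with
    | C a => simp [F.algebraMap_mem a]
    | add p q hp hq => rw [map_add]; exact F.add_mem hp hq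
    | mul_X p i hp => rw [map_mul, aeval_X]; exact F.mul_mem hp (hw i)
  have hDpoly : ∀ P : MvPolynomial ι k, D (aeval w P) ∈ F := by
    intro P
    rw [chain]
    exact F.sum_mem fun i _ => F.mul_mem (hpoly _) (hDw i)
  have hK : ∀ c ∈ IntermediateField.adjoin k (Set.range w), c ∈ F ∧ D c ∈ F := by
    intro c hc
    obtain ⟨r, s, rfl⟩ := (IntermediateField.mem_adjoin_range_iff k w c).1 hc
    refine ⟨F.div_mem (hpoly _) (hpoly _), ?_⟩
    rw [div_eq_mul_inv, Derivation.leibniz, Derivation.leibniz_inv]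
    simp only [smul_eq_mul]
    refine F.add_mem (F.mul_mem (hpoly _) (F.mul_mem (F.neg_mem (pow_mem (F.inv_mem (hpoly _)) 2)) (hDpoly _))) 
      (F.mul_mem (F.inv_mem (hpoly _)) (hDpoly _))
  set K := IntermediateField.adjoin k (Set.range w) with hKdef
  have hq : ∀ q : Polynomial K, Polynomial.aeval a q ∈ F ∧ D (Polynomial.aeval a q) - Polynomial.aeval a q.derivative * D a ∈ F := by
    intro q
    induction q using Polynomial.induction_on' with
    | add p q hp hq =>
      refine ⟨by rw [map_add]; exact F.add_mem hp.1 hq.1, ?_⟩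
      convert F.add_mem hp.2 hq.2 using 1
      simp only [map_add]; ring
    | monomial j c =>
      have hc := hK c c.2
      rw [Polynomial.aeval_monomial, Polynomial.derivative_monomial, Polynomial.aeval_monomial]
      refine ⟨F.mul_mem hc.1 (pow_mem ha j), ?_⟩
      convert F.mul_mem (pow_mem ha j) hc.2 using 1
      change _ = a ^ j * D (algebraMap K M c)
      rw [Derivation.leibniz, Derivation.leibniz_pow]
      simp only [smul_eq_mul, nsmul_eq_mul, map_mul, map_natCast]
      ring
  have hintg := hal.isIntegral
  have h1 := (hq (minpoly K a)).2
  have h2 := (hq (minpoly K a).derivative).1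
  have : CharZero K := charZero_of_injective_algebraMap (algebraMap k K).injective
  have hsep : Polynomial.aeval a (minpoly K a).derivative ≠ 0 := by
    exact (minpoly.irreducible hintg).separable.aeval_derivative_ne_zero (minpoly.aeval K a)
  rw [minpoly.aeval, map_zero, zero_sub] at h1
  have := F.div_mem (F.neg_mem h1) h2
  rwa [neg_neg, mul_div_cancel_left₀ _ hsep] at this

end Alg
end AATAux

namespace AATAux

section An

variable (E : Type*) [NormedAddCommGroup E] [NormedSpace ℂ E]

/-- The algebra of entire functions. -/
def Entire : Subalgebra ℂ (E → ℂ) where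
  carrier := {f | ∀ u, AnalyticAt ℂ f u}
  mul_mem' := fun ha hb u => (ha u).mul (hb u)
  add_mem' := fun ha hb u => (ha u).add (hb u)
  algebraMap_mem' := fun _ _ => analyticAt_const

variable {E}

theorem Entire.analytic (f : Entire E) (u : E) : AnalyticAt ℂ (f : E → ℂ) u := f.2 u

theorem Entire.exists_ne {f : Entire E} (hf : f ≠ 0) : ∃ u, (f : E → ℂ) u ≠ 0 := by
  by_contra! h
  exact hf (Subtype.ext (funext h))

theorem Entire.eq_zero_of_eventually {f : Entire E} {u : E}
    (h : ∀ᶠ v in nhds u, (f : E → ℂ) v = 0) : f = 0 := by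
  apply Subtype.ext
  exact AnalyticOnNhd.eq_of_eventuallyEq (fun v _ => f.2 v) (fun v _ => analyticAt_const) h

instance : IsDomain (Entire E) := by
  have : NoZeroDivisors (Entire E) := ⟨fun {f g} hfg => by
    by_contra! h
    obtain ⟨u, hu⟩ := Entire.exists_ne h.1
    refine h.2 (Entire.eq_zero_of_eventually (u := u) ?_)
    filter_upwards [(f.2 u).continuousAt.eventually_ne hu] with v hv
    have : (f : E → ℂ) v * (g : E → ℂ) v = 0 := congrFun (congrArg Subtype.val hfg) v
    exact (mul_eq_zero.1 this).resolve_left hv⟩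
  have : Nontrivial (Entire E) := ⟨0, 1, fun h => by
    have : (0 : ℂ) = 1 := congrFun (congrArg Subtype.val h) (0 : E)
    exact zero_ne_one this⟩
  exact NoZeroDivisors.to_isDomain _

/-- generic property -/
def Gen (P : E → Prop) : Prop := ∃ h : Entire E, h ≠ 0 ∧ ∀ u, (h : E → ℂ) u ≠ 0 → P u

theorem Gen.mono {P Q : E → Prop} (h : Gen P) (hPQ : ∀ u, P u → Q u) : Gen Q := by
  obtain ⟨f, hf, hP⟩ := h
  exact ⟨f, hf, fun u hu => hPQ u (hP u hu)⟩

theorem Gen.and {P Q : E → Prop} (h : Gen P) (h' : Gen Q) : Gen (fun u => P u ∧ Q u) := by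
  obtain ⟨f, hf, hP⟩ := h
  obtain ⟨g, hg, hQ⟩ := h'
  refine ⟨f * g, mul_ne_zero hf hg, fun u hu => ?_⟩
  have hu' : (f : E → ℂ) u * (g : E → ℂ) u ≠ 0 := hu
  exact ⟨hP u (left_ne_zero_of_mul hu'), hQ u (right_ne_zero_of_mul hu')⟩

theorem Gen.all {ι : Type*} [Finite ι] {P : ι → E → Prop} (h : ∀ i, Gen (P i)) :
    Gen (fun u => ∀ i, P i u) := by
  have := Fintype.ofFinite ι
  choose f hf hP using h
  refine ⟨∏ i, f i, Finset.prod_ne_zero_iff.2 fun i _ => hf i, fun u hu i => hP i u ?_⟩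
  intro h0
  apply hu
  have : ((∏ i, f i : Entire E) : E → ℂ) u = ∏ i, (f i : E → ℂ) u := by
    rw [SubmonoidClass.coe_finsetProd, Finset.prod_apply]
  rw [this]
  exact Finset.prod_eq_zero (Finset.mem_univ i) h0

theorem Gen.exists {P : E → Prop} (h : Gen P) : ∃ u, P u := by
  obtain ⟨f, hf, hP⟩ := h
  obtain ⟨u, hu⟩ := Entire.exists_ne hf
  exact ⟨u, hP u hu⟩

theorem Gen.frequently {P : E → Prop} (h : Gen P) (u : E) : ∃ᶠ v in nhds u, P v := by
  obtain ⟨f, hf, hP⟩ := h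
  intro hc
  refine hf (Entire.eq_zero_of_eventually (u := u) ?_)
  filter_upwards [hc] with v hv
  by_contra h0
  exact hv (hP v h0)

theorem Gen.eq_zero {f : E → ℂ} (h : Gen (fun u => f u = 0)) {u : E} (hf : ContinuousAt f u) :
    f u = 0 := by
  by_contra h0
  exact h.frequently u ((hf.eventually_ne h0).mono fun v hv => hv)

theorem Gen.comp {E' : Type*} [NormedAddCommGroup E'] [NormedSpace ℂ E'] {P : E → Prop}
    (h : Gen P) (L : E' → E) (hL : ∀ u, AnalyticAt ℂ L u) (hs : Function.Surjective L) :
    Gen (fun u => P (L u)) := by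
  obtain ⟨f, hf, hP⟩ := h
  refine ⟨⟨fun u => (f : E → ℂ) (L u), fun u => (f.2 _).comp (hL u)⟩, fun h0 => ?_, fun u hu => hP _ hu⟩
  obtain ⟨v, hv⟩ := Entire.exists_ne hf
  obtain ⟨u, rfl⟩ := hs v
  exact hv (congrFun (congrArg Subtype.val h0) u)

theorem Gen.slice {E' : Type*} [NormedAddCommGroup E'] [NormedSpace ℂ E'] {P : E × E' → Prop}
    (h : Gen P) : ∃ b, Gen (fun u => P (u, b)) := by
  obtain ⟨f, hf, hP⟩ := h
  obtain ⟨⟨a, b⟩, hv⟩ := Entire.exists_ne hf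
  refine ⟨b, ⟨fun u => (f : E × E' → ℂ) (u, b), fun u => AnalyticAt.fun_comp (f.2 (u, b))
    (analyticAt_id.prod analyticAt_const)⟩, fun h0 => ?_,
    fun u hu => hP _ hu⟩
  exact hv (congrFun (congrArg Subtype.val h0) a)

/-- the field of meromorphic functions -/
def Mer (E : Type*) [NormedAddCommGroup E] [NormedSpace ℂ E] := FractionRing (Entire E)

noncomputable instance : Field (Mer E) := inferInstanceAs (Field (FractionRing (Entire E)))

noncomputable instance : Algebra ℂ (Mer E) := inferInstanceAs (Algebra ℂ (FractionRing (Entire E)))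

noncomputable instance : Algebra (Entire E) (Mer E) :=
  inferInstanceAs (Algebra (Entire E) (FractionRing (Entire E)))

instance : IsFractionRing (Entire E) (Mer E) :=
  inferInstanceAs (IsFractionRing (Entire E) (FractionRing (Entire E)))

instance : IsScalarTower ℂ (Entire E) (Mer E) :=
  IsScalarTower.of_algebraMap_eq fun _ => rfl

/-- `m` is represented by the function `f` -/
def Rep (m : Mer E) (f : E → ℂ) : Prop :=
  ∃ g h : Entire E, h ≠ 0 ∧ m * algebraMap (Entire E) (Mer E) h = algebraMap (Entire E) (Mer E) g ∧
    ∀ u, (h : E → ℂ) u ≠ 0 → f u * (h : E → ℂ) u = (g : E → ℂ) u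

theorem amap_ne {h : Entire E} (hh : h ≠ 0) : algebraMap (Entire E) (Mer E) h ≠ 0 := by
  exact fun h0 => hh ((map_eq_zero_iff _ (IsFractionRing.injective (Entire E) (Mer E))).1 h0)

theorem Rep.gen_zero {f : E → ℂ} (h : Rep 0 f) : Gen (fun u => f u = 0) := by
  obtain ⟨g, h, hh, hm, hf⟩ := h
  refine ⟨h, hh, fun u hu => ?_⟩
  have : g = 0 := by
    rw [zero_mul] at hm
    exact (map_eq_zero_iff _ (IsFractionRing.injective (Entire E) (Mer E))).1 hm.symm
  have h2 := hf u hu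
  rw [this] at h2
  exact (mul_eq_zero.1 h2).resolve_right hu

theorem Rep.eq_zero {m : Mer E} {f : E → ℂ} (h : Rep m f) (h0 : Gen (fun u => f u = 0)) : m = 0 := by
  obtain ⟨g, h, hh, hm, hf⟩ := h
  obtain ⟨h', hh', hf'⟩ := h0
  have hg : g * (h * h') = 0 := by
    apply Subtype.ext
    funext u
    change (g : E → ℂ) u * ((h : E → ℂ) u * (h' : E → ℂ) u) = 0
    by_cases h1 : (h : E → ℂ) u = 0
    · simp [h1]
    by_cases h2 : (h' : E → ℂ) u = 0
    · simp [h2]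
    rw [← hf u h1, hf' u h2]
    simp
  have hg0 : g = 0 := (mul_eq_zero.1 hg).resolve_right (mul_ne_zero hh hh')
  rw [hg0, map_zero] at hm
  exact (mul_eq_zero.1 hm).resolve_right (amap_ne hh)

theorem Rep.gen_ne {m : Mer E} {f : E → ℂ} (h : Rep m f) (h0 : m ≠ 0) : Gen (fun u => f u ≠ 0) := by
  obtain ⟨g, h, hh, hm, hf⟩ := h
  have hg : g ≠ 0 := by
    rintro rfl
    rw [map_zero] at hm
    exact h0 ((mul_eq_zero.1 hm).resolve_right (amap_ne hh))
  refine ⟨g * h, mul_ne_zero hg hh, fun u hu hfu => ?_⟩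
  have hu' : (g : E → ℂ) u * (h : E → ℂ) u ≠ 0 := hu
  apply left_ne_zero_of_mul hu'
  rw [← hf u (right_ne_zero_of_mul hu'), hfu, zero_mul]

theorem Rep.add {m m' : Mer E} {f f' : E → ℂ} (hm : Rep m f) (hm' : Rep m' f') :
    Rep (m + m') (fun u => f u + f' u) := by
  obtain ⟨g, h, hh, hm, hf⟩ := hm
  obtain ⟨g', h', hh', hm', hf'⟩ := hm'
  refine ⟨g * h' + g' * h, h * h', mul_ne_zero hh hh', ?_, fun u hu => ?_⟩
  · simp only [map_mul, map_add, ← hm, ← hm']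
    ring
  · have hu' : (h : E → ℂ) u * (h' : E → ℂ) u ≠ 0 := hu
    change (f u + f' u) * ((h : E → ℂ) u * (h' : E → ℂ) u) =
      (g : E → ℂ) u * (h' : E → ℂ) u + (g' : E → ℂ) u * (h : E → ℂ) u
    rw [← hf u (left_ne_zero_of_mul hu'), ← hf' u (right_ne_zero_of_mul hu')]
    ring

theorem Rep.mul {m m' : Mer E} {f f' : E → ℂ} (hm : Rep m f) (hm' : Rep m' f') :
    Rep (m * m') (fun u => f u * f' u) := by
  obtain ⟨g, h, hh, hm, hf⟩ := hm
  obtain ⟨g', h', hh', hm', hf'⟩ := hm'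
  refine ⟨g * g', h * h', mul_ne_zero hh hh', ?_, fun u hu => ?_⟩
  · simp only [map_mul, ← hm, ← hm']
    ring
  · have hu' : (h : E → ℂ) u * (h' : E → ℂ) u ≠ 0 := hu
    change (f u * f' u) * ((h : E → ℂ) u * (h' : E → ℂ) u) =
      (g : E → ℂ) u * (g' : E → ℂ) u
    rw [← hf u (left_ne_zero_of_mul hu'), ← hf' u (right_ne_zero_of_mul hu')]
    ring

theorem Rep.const (c : ℂ) : Rep (algebraMap ℂ (Mer E) c) (fun _ => c) := by
  refine ⟨algebraMap ℂ (Entire E) c, 1, one_ne_zero, ?_, fun u _ => ?_⟩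
  · rw [map_one, mul_one, ← IsScalarTower.algebraMap_apply]
  · exact mul_one c

theorem Rep.sum {ι : Type*} (s : Finset ι) {m : ι → Mer E} {f : ι → E → ℂ}
    (hm : ∀ i, Rep (m i) (f i)) : Rep (∑ i ∈ s, m i) (fun u => ∑ i ∈ s, f i u) := by
  classical
  induction s using Finset.induction_on with
  | empty => simpa using Rep.const (E := E) 0
  | insert i s hi ih =>
    simp only [Finset.sum_insert hi]
    exact (hm i).add ih

theorem Rep.congr {m : Mer E} {f f' : E → ℂ} (hm : Rep m f) (h : Gen (fun u => f u = f' u)) :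
    Rep m f' := by
  obtain ⟨g, h1, hh, hm, hf⟩ := hm
  obtain ⟨h2, hh2, he⟩ := h
  refine ⟨g * h2, h1 * h2, mul_ne_zero hh hh2, ?_, fun u hu => ?_⟩
  · simp only [map_mul, ← hm]
    ring
  · have hu' : (h1 : E → ℂ) u * (h2 : E → ℂ) u ≠ 0 := hu
    change f' u * ((h1 : E → ℂ) u * (h2 : E → ℂ) u) = (g : E → ℂ) u * (h2 : E → ℂ) u
    rw [← he u (right_ne_zero_of_mul hu'), ← hf u (left_ne_zero_of_mul hu')]
    ring

theorem Rep.poly {σ : Type*} {m : σ → Mer E} {f : σ → E → ℂ} (hm : ∀ i, Rep (m i) (f i))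
    (P : MvPolynomial σ ℂ) : Rep (aeval m P) (fun u => eval (fun i => f i u) P) := by
  induction P using MvPolynomial.induction_on with
  | C a => simpa [← algebraMap_eq] using Rep.const (E := E) a
  | add p q hp hq => simpa using hp.add hq
  | mul_X p i hp => simpa using hp.mul (hm i)

theorem Rep.analytic {m : Mer E} {f : E → ℂ} (hm : Rep m f) : Gen (fun u => AnalyticAt ℂ f u) := by
  obtain ⟨g, h, hh, hm, hf⟩ := hm
  refine ⟨h, hh, fun u hu => ?_⟩
  refine ((g.2 u).div (h.2 u) hu).congr ?_
  filter_upwards [(h.2 u).continuousAt.eventually_ne hu] with v hv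
  rw [Pi.div_apply, ← hf v hv, mul_div_cancel_right₀ _ hv]

/-- directional derivative on entire functions -/
noncomputable def dEnt (e : E) : Derivation ℂ (Entire E) (Entire E) :=
  Derivation.mk'
    { toFun := fun f => ⟨fun u => fderiv ℂ (f : E → ℂ) u e, fun u =>
        ((ContinuousLinearMap.apply ℂ ℂ e : (E →L[ℂ] ℂ) →L[ℂ] ℂ).analyticAt _).comp (f.2 u).fderiv⟩
      map_add' := fun f g => Subtype.ext <| funext fun u => by
        change fderiv ℂ ((f : E → ℂ) + (g : E → ℂ)) u e = fderiv ℂ (f : E → ℂ) u e + fderiv ℂ (g : E → ℂ) u e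
        rw [fderiv_add (f.2 u).differentiableAt (g.2 u).differentiableAt]
        rfl
      map_smul' := fun c f => Subtype.ext <| funext fun u => by
        change fderiv ℂ (c • (f : E → ℂ)) u e = c • fderiv ℂ (f : E → ℂ) u e
        rw [fderiv_const_smul (f.2 u).differentiableAt]
        rfl }
    (fun f g => Subtype.ext <| funext fun u => by
      change fderiv ℂ ((f : E → ℂ) * (g : E → ℂ)) u e = (f : E → ℂ) u * fderiv ℂ (g : E → ℂ) u e +
        (g : E → ℂ) u * fderiv ℂ (f : E → ℂ) u e
      rw [fderiv_mul (f.2 u).differentiableAt (g.2 u).differentiableAt]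
      rfl)

/-- directional derivative on meromorphic functions -/
noncomputable def dMer (e : E) : Derivation ℂ (Mer E) (Mer E) := (exists_deriv (dEnt e)).choose

theorem dMer_amap (e : E) (f : Entire E) :
    dMer e (algebraMap (Entire E) (Mer E) f) = algebraMap (Entire E) (Mer E) (dEnt e f) :=
  (exists_deriv (dEnt e)).choose_spec f

theorem Rep.deriv {m : Mer E} {f : E → ℂ} (hm : Rep m f) (e : E) :
    Rep (dMer e m) (fun u => fderiv ℂ f u e) := by
  obtain ⟨g, h, hh, hm, hf⟩ := hm
  refine ⟨dEnt e g * h - g * dEnt e h, h * h, mul_ne_zero hh hh, ?_, fun u hu => ?_⟩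
  · have := congrArg (dMer e) hm
    rw [Derivation.leibniz, dMer_amap, dMer_amap, smul_eq_mul, smul_eq_mul] at this
    simp only [map_mul, map_sub, ← this, ← hm]
    ring
  · have hu' : (h : E → ℂ) u * (h : E → ℂ) u ≠ 0 := hu
    have hu1 := left_ne_zero_of_mul hu'
    have hfa : AnalyticAt ℂ f u := by
      refine ((g.2 u).div (h.2 u) hu1).congr ?_
      filter_upwards [(h.2 u).continuousAt.eventually_ne hu1] with v hv
      rw [Pi.div_apply, ← hf v hv, mul_div_cancel_right₀ _ hv]
    have hev : f * (h : E → ℂ) =ᶠ[nhds u] (g : E → ℂ) := by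
      filter_upwards [(h.2 u).continuousAt.eventually_ne hu1] with v hv using hf v hv
    have h1 := congrArg (fun L : E →L[ℂ] ℂ => L e) (hev.fderiv_eq (𝕜 := ℂ))
    simp only [fderiv_mul hfa.differentiableAt (h.2 u).differentiableAt] at h1
    have h2 : f u * fderiv ℂ (h : E → ℂ) u e + (h : E → ℂ) u * fderiv ℂ f u e =
      fderiv ℂ (g : E → ℂ) u e := h1
    change fderiv ℂ f u e * ((h : E → ℂ) u * (h : E → ℂ) u) = fderiv ℂ (g : E → ℂ) u e * (h : E → ℂ) u
      - (g : E → ℂ) u * fderiv ℂ (h : E → ℂ) u e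
    rw [← h2, ← hf u hu1]
    ring

theorem algIndep_of_open {ι : Type*} [Finite ι] {X : ι → Mer E} {F : ι → E → ℂ}
    (hX : ∀ i, Rep (X i) (F i)) (p : E) (hF : ∀ i, AnalyticAt ℂ (F i) p)
    (hop : nhds (fun i => F i p) ≤ Filter.map (fun u i => F i u) (nhds p)) :
    AlgebraicIndependent ℂ X := by
  have := Fintype.ofFinite ι
  rw [algebraicIndependent_iff]
  intro P hP
  have h1 : Gen (fun u => eval (fun i => F i u) P = 0) := by
    have := Rep.poly hX P
    rw [hP] at this
    exact this.gen_zero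
  have h2 : ∀ᶠ u in nhds p, eval (fun i => F i u) P = 0 := by
    filter_upwards [Filter.eventually_all.2 fun i => (hF i).eventually_analyticAt] with u hu
    refine h1.eq_zero ?_
    have hc : Continuous (fun z : ι → ℂ => eval z P) := MvPolynomial.continuous_eval P
    exact ContinuousAt.comp (g := fun z : ι → ℂ => eval z P) (f := fun u i => F i u) hc.continuousAt
      (continuousAt_pi.2 fun i => (hu i).continuousAt)
  have h3 : ∀ᶠ z in nhds (fun i => F i p), eval z P = 0 := hop h2
  obtain ⟨ε, hε, hball⟩ := Metric.eventually_nhds_iff.1 h3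
  refine MvPolynomial.funext_set (fun i => Metric.ball (F i p) ε) (fun i => ?_) fun z hz => ?_
  · exact infinite_of_mem_nhds _ (Metric.ball_mem_nhds (F i p) hε)
  · rw [map_zero]
    exact hball ((dist_pi_lt_iff hε).2 fun i => hz i trivial)

end An
end AATAux

namespace AATAux

theorem aeval_mem {k M : Type*} [Field k] [Field M] [Algebra k M] {σ : Type*}
    (F : IntermediateField k M) (w : σ → M) (hw : ∀ i, w i ∈ F) (P : MvPolynomial σ k) :
    aeval w P ∈ F := by
  induction P using MvPolynomial.induction_on with
  | C a => simp [F.algebraMap_mem a]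
  | add p q hp hq => rw [map_add]; exact F.add_mem hp hq
  | mul_X p i hp => rw [map_mul, aeval_X]; exact F.mul_mem hp (hw i)

section Comp

variable {E E' : Type*} [NormedAddCommGroup E] [NormedSpace ℂ E]
  [NormedAddCommGroup E'] [NormedSpace ℂ E']

theorem exists_rep {g h : E → ℂ} {f : E → ℂ} (hg : ∀ u, AnalyticAt ℂ g u)
    (hh : ∀ u, AnalyticAt ℂ h u) (h0 : ∃ u, h u ≠ 0) (hf : ∀ u, h u ≠ 0 → f u = g u / h u) :
    ∃ m : Mer E, Rep m f := by
  have hne : (⟨h, hh⟩ : Entire E) ≠ 0 := by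
    intro h1
    obtain ⟨u, hu⟩ := h0
    exact hu (congrFun (congrArg Subtype.val h1) u)
  refine ⟨algebraMap (Entire E) (Mer E) ⟨g, hg⟩ / algebraMap (Entire E) (Mer E) ⟨h, hh⟩,
    ⟨g, hg⟩, ⟨h, hh⟩, hne, div_mul_cancel₀ _ (amap_ne hne), fun u hu => ?_⟩
  rw [hf u hu]
  exact div_mul_cancel₀ _ hu

theorem exists_rep_comp {n : ℕ} {f : (Fin n → ℂ) → ℂ} (hf : Mero f) (L : E → (Fin n → ℂ))
    (hL : ∀ u, AnalyticAt ℂ L u) (hs : Function.Surjective L) :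
    ∃ m : Mer E, Rep m (fun u => f (L u)) := by
  obtain ⟨g, h, hg, hh, ⟨u0, hu0⟩, hq⟩ := hf
  obtain ⟨v0, rfl⟩ := hs u0
  exact exists_rep (g := fun u => g (L u)) (h := fun u => h (L u))
    (fun u => (hg _).comp (hL u)) (fun u => (hh _).comp (hL u)) ⟨v0, hu0⟩ fun u hu => hq _ hu

end Comp

theorem open_of_jac {n : ℕ} {φ : Fin n → (Fin n → ℂ) → ℂ} {u : Fin n → ℂ}
    (ha : ∀ j, AnalyticAt ℂ (φ j) u)
    (hd : Matrix.det (Matrix.of fun k p => pd (φ k) p u) ≠ 0) :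
    nhds (fun i => φ i u) ≤ Filter.map (fun v i => φ i v) (nhds u) := by
  have h1 : HasStrictFDerivAt (fun v i => φ i v)
      (ContinuousLinearMap.pi fun j => fderiv ℂ (φ j) u) u :=
    hasStrictFDerivAt_pi' |>.2 fun j => (ha j).hasStrictFDerivAt
  refine (h1.map_nhds_eq_of_surj ?_).ge
  rw [LinearMap.range_eq_top]
  have h2 : Function.Surjective (Matrix.of fun k p => pd (φ k) p u).mulVec := by
    rw [Matrix.mulVec_surjective_iff_isUnit, Matrix.isUnit_iff_isUnit_det]
    exact isUnit_iff_ne_zero.2 hd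
  intro y
  obtain ⟨x, hx⟩ := h2 y
  refine ⟨x, ?_⟩
  rw [← hx]
  funext j
  change fderiv ℂ (φ j) u x = _
  conv_lhs => rw [pi_eq_sum_univ' x]
  simp only [map_sum, map_smul, Matrix.mulVec, dotProduct, Matrix.of_apply, pd]
  refine Finset.sum_congr rfl fun i _ => ?_
  rw [smul_eq_mul, mul_comm]

theorem pdIter_shift {n : ℕ} (f : (Fin n → ℂ) → ℂ) (b : Fin n → ℂ) (L : List (Fin n)) :
    ∀ u, pdIter (fun u => f (u + b)) L u = pdIter f L (u + b) := by
  induction L with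
  | nil => intro u; rfl
  | cons p L ih =>
    intro u
    have : pdIter (fun u => f (u + b)) L = fun u => pdIter f L (u + b) := funext ih
    change fderiv ℂ (pdIter (fun u => f (u + b)) L) u _ = fderiv ℂ (pdIter f L) (u + b) _
    rw [this, fderiv_comp_add_right]

theorem pd_analytic {n : ℕ} {f : (Fin n → ℂ) → ℂ} {u : Fin n → ℂ} (hf : AnalyticAt ℂ f u)
    (p : Fin n) : AnalyticAt ℂ (pd f p) u :=
  ((ContinuousLinearMap.apply ℂ ℂ (Pi.single p 1) : ((Fin n → ℂ) →L[ℂ] ℂ) →L[ℂ] ℂ).analyticAt _).comp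
    hf.fderiv

/-- The functions on `ℂⁿ × ℂⁿ` entering the addition theorem. -/
noncomputable def zf {n : ℕ} (φ : Fin n → (Fin n → ℂ) → ℂ) (k : Fin n) :
    Option (Fin n ⊕ Fin n) → (Fin n → ℂ) × (Fin n → ℂ) → ℂ
  | none => fun q => φ k (q.1 + q.2)
  | some (Sum.inl j) => fun q => φ j q.1
  | some (Sum.inr j) => fun q => φ j q.2

theorem zf_eq {n : ℕ} (φ : Fin n → (Fin n → ℂ) → ℂ) (k : Fin n) (u v : Fin n → ℂ) :
    (fun i => zf φ k i (u, v)) =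
      fun i => i.elim (φ k (u + v)) (Sum.elim (fun j => φ j u) fun j => φ j v) := by
  funext i
  rcases i with _ | j | j <;> rfl

/-- The `p`-th partial derivative as a derivation on meromorphic functions. -/
noncomputable def dP {n : ℕ} (p : Fin n) : Derivation ℂ (Mer (Fin n → ℂ)) (Mer (Fin n → ℂ)) :=
  dMer (Pi.single p 1 : Fin n → ℂ)

theorem gen_relation {E : Type*} [NormedAddCommGroup E] [NormedSpace ℂ E] {σ : Type*} [Fintype σ]
    (e : E) {z : σ → Mer E} {f : σ → E → ℂ} (hz : ∀ i, Rep (z i) (f i)) (G : MvPolynomial σ ℂ)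
    (h0 : aeval z G = 0) :
    Gen (fun q => ∑ i, eval (fun i => f i q) (pderiv i G) * fderiv ℂ (f i) q e = 0) := by
  have h2 := chain (dMer e) z G
  rw [h0, map_zero] at h2
  have h3 := Rep.sum Finset.univ (fun i => (Rep.poly hz (pderiv i G)).mul ((hz i).deriv e))
  refine Rep.gen_zero ?_
  rw [h2]
  exact h3

theorem exists_G {n : ℕ} (φ : Fin n → (Fin n → ℂ) → ℂ)
    (hmero : ∀ k, Mero (φ k)) (hindep : AnalyticallyIndep φ) (haat : AdmitsAAT φ) (k : Fin n) :
    ∃ G : MvPolynomial (Option (Fin n ⊕ Fin n)) ℂ,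
      Gen (fun q : (Fin n → ℂ) × (Fin n → ℂ) =>
        eval (fun i => zf φ k i q) G = 0 ∧ eval (fun i => zf φ k i q) (pderiv none G) ≠ 0 ∧
        ∀ p : Fin n, eval (fun i => zf φ k i q) (pderiv none G) * pd (φ k) p (q.1 + q.2) +
          ∑ j, eval (fun i => zf φ k i q) (pderiv (some (Sum.inr j)) G) * pd (φ j) p q.2 = 0) := by
  have hfst : ∀ q : (Fin n → ℂ) × (Fin n → ℂ), AnalyticAt ℂ (fun q => q.1) q := fun q => analyticAt_fst
  have hsnd : ∀ q : (Fin n → ℂ) × (Fin n → ℂ), AnalyticAt ℂ (fun q => q.2) q := fun q => analyticAt_snd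
  have hadd : ∀ q : (Fin n → ℂ) × (Fin n → ℂ), AnalyticAt ℂ (fun q => q.1 + q.2) q :=
    fun q => (hfst q).add (hsnd q)
  have hrep : ∀ i, ∃ m, Rep m (zf φ k i) := by
    rintro (_ | j | j)
    · exact exists_rep_comp (hmero k) _ hadd fun y => ⟨(y, 0), by simp⟩
    · exact exists_rep_comp (hmero j) _ hfst fun y => ⟨(y, 0), by simp⟩
    · exact exists_rep_comp (hmero j) _ hsnd fun y => ⟨(0, y), by simp⟩
  choose z hz using hrep
  -- generic analyticity
  have hanE : ∀ j, Gen (fun u => AnalyticAt ℂ (φ j) u) := fun j => by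
    obtain ⟨m, hm⟩ := exists_rep_comp (hmero j) (fun u => u) (fun u => analyticAt_id) Function.surjective_id
    exact hm.analytic
  have hall := Gen.all hanE
  have hgen : Gen (fun q : (Fin n → ℂ) × (Fin n → ℂ) => (∀ j, AnalyticAt ℂ (φ j) q.1) ∧
      (∀ j, AnalyticAt ℂ (φ j) q.2) ∧ AnalyticAt ℂ (φ k) (q.1 + q.2)) :=
    (hall.comp _ hfst fun y => ⟨(y, 0), by simp⟩).and
      ((hall.comp _ hsnd fun y => ⟨(0, y), by simp⟩).and
        ((hanE k).comp _ hadd fun y => ⟨(y, 0), by simp⟩))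
  obtain ⟨G, hGd, hG⟩ := haat k
  have hG0 : G ≠ 0 := by
    rintro rfl
    simp at hGd
  have hzG : aeval z G = 0 := by
    refine (Rep.poly hz G).eq_zero (hgen.mono ?_)
    rintro ⟨u, v⟩ ⟨h1, h2, h3⟩
    rw [zf_eq]
    exact hG u v h1 h2 h3
  have hind : AlgebraicIndependent ℂ (fun i => z (some i)) := by
    obtain ⟨u0, ha, hd⟩ := hindep
    refine algIndep_of_open (F := fun i => zf φ k (some i)) (fun i => hz (some i)) (u0, u0) ?_ ?_
    · rintro (j | j)
      · exact AnalyticAt.fun_comp (g := φ j) (f := fun q : (Fin n → ℂ) × (Fin n → ℂ) => q.1) (ha j) (hfst (u0, u0))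
      · exact AnalyticAt.fun_comp (g := φ j) (f := fun q : (Fin n → ℂ) × (Fin n → ℂ) => q.2) (ha j) (hsnd (u0, u0))
    · have ho := open_of_jac ha hd
      intro s hs
      rw [Filter.mem_map] at hs
      let H : (Fin n → ℂ) × (Fin n → ℂ) → (Fin n ⊕ Fin n → ℂ) := fun y => Sum.elim y.1 y.2
      have h1 : H ⁻¹' s ∈ nhds ((fun i => φ i u0), (fun i => φ i u0)) := by
        have h2 := Filter.prod_mono ho ho
        rw [Filter.prod_map_map_eq, ← nhds_prod_eq, ← nhds_prod_eq] at h2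
        refine h2 ?_
        rw [Filter.mem_map]
        refine Filter.mem_of_superset hs ?_
        rintro ⟨u, v⟩ huv
        have : (fun i => zf φ k (some i) (u, v)) = H ((fun i => φ i u), (fun i => φ i v)) := by
          funext i
          rcases i with j | j <;> rfl
        simp only [Set.mem_preimage] at huv ⊢
        rw [← this]
        exact huv
      let R : (Fin n ⊕ Fin n → ℂ) → (Fin n → ℂ) × (Fin n → ℂ) :=
        fun y => (fun j => y (Sum.inl j), fun j => y (Sum.inr j))
      have hR : Continuous R := by fun_prop
      have h3 : R ⁻¹' (H ⁻¹' s) ∈ nhds (fun i => zf φ k (some i) (u0, u0)) :=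
        hR.continuousAt.preimage_mem_nhds h1
      refine Filter.mem_of_superset h3 ?_
      intro y hy
      have : H (R y) = y := by
        funext i
        rcases i with j | j <;> rfl
      simpa [this] using hy
  obtain ⟨G', h0, h1⟩ := exists_min z hind G hG0 hzG
  refine ⟨G', ?_⟩
  have g0 : Gen (fun q => eval (fun i => zf φ k i q) G' = 0) := by
    have := Rep.poly hz G'
    rw [h0] at this
    exact this.gen_zero
  have g1 := (Rep.poly hz (pderiv none G')).gen_ne h1
  have g2 : Gen (fun q => ∀ p : Fin n, ∑ i, eval (fun i => zf φ k i q) (pderiv i G') *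
      fderiv ℂ (zf φ k i) q ((0 : Fin n → ℂ), (Pi.single p 1 : Fin n → ℂ)) = 0) := by
    refine Gen.all fun p => ?_
    exact gen_relation _ hz G' h0
  refine (g0.and (g1.and (g2.and hgen))).mono ?_
  rintro ⟨u, v⟩ ⟨q0, q1, q2, a1, a2, a3⟩
  refine ⟨q0, q1, fun p => ?_⟩
  have := q2 p
  rw [Fintype.sum_option, Fintype.sum_sum_type] at this
  have e1 : ∀ e : (Fin n → ℂ) × (Fin n → ℂ), fderiv ℂ (zf φ k none) (u, v) e = fderiv ℂ (φ k) (u + v) (e.1 + e.2) := by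
    intro e
    have hL : HasFDerivAt (fun q : (Fin n → ℂ) × (Fin n → ℂ) => q.1 + q.2)
      (ContinuousLinearMap.fst ℂ (Fin n → ℂ) (Fin n → ℂ) + ContinuousLinearMap.snd ℂ (Fin n → ℂ) (Fin n → ℂ)) (u, v) :=
      hasFDerivAt_fst.add hasFDerivAt_snd
    have := HasFDerivAt.comp (u, v) (g := φ k) (f := fun q : (Fin n → ℂ) × (Fin n → ℂ) => q.1 + q.2)
      a3.differentiableAt.hasFDerivAt hL
    exact congrArg (fun L => L e) this.fderiv
  have e2 : ∀ j, ∀ e : (Fin n → ℂ) × (Fin n → ℂ), fderiv ℂ (zf φ k (some (Sum.inl j))) (u, v) e = fderiv ℂ (φ j) u e.1 := by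
    intro j e
    have := HasFDerivAt.comp (u, v) (g := φ j) (f := fun q : (Fin n → ℂ) × (Fin n → ℂ) => q.1)
      (a1 j).differentiableAt.hasFDerivAt (hasFDerivAt_fst (𝕜 := ℂ))
    exact congrArg (fun L => L e) this.fderiv
  have e3 : ∀ j, ∀ e : (Fin n → ℂ) × (Fin n → ℂ), fderiv ℂ (zf φ k (some (Sum.inr j))) (u, v) e = fderiv ℂ (φ j) v e.2 := by
    intro j e
    have := HasFDerivAt.comp (u, v) (g := φ j) (f := fun q : (Fin n → ℂ) × (Fin n → ℂ) => q.2)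
      (a2 j).differentiableAt.hasFDerivAt (hasFDerivAt_snd (𝕜 := ℂ))
    exact congrArg (fun L => L e) this.fderiv
  simpa [e1, e2, e3, pd] using this

theorem core {n : ℕ} {K : Type*} [Field K] [Algebra ℂ K] (D : Fin n → Derivation ℂ K K)
    (x w : Fin n → K) (c : Fin n → ℂ) (c' : Fin n → Fin n → ℂ)
    (ez : Fin n → Option (Fin n ⊕ Fin n) → K)
    (hezw : ∀ i, ez i none = w i) (hezx : ∀ i j, ez i (some (Sum.inl j)) = x j)
    (hezc : ∀ i j, ez i (some (Sum.inr j)) = algebraMap ℂ K (c j))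
    (G : Fin n → MvPolynomial (Option (Fin n ⊕ Fin n)) ℂ)
    (r0 : ∀ i, aeval (ez i) (G i) = 0) (r1 : ∀ i, aeval (ez i) (pderiv none (G i)) ≠ 0)
    (r2 : ∀ i p, aeval (ez i) (pderiv none (G i)) * D p (w i) +
      ∑ j, aeval (ez i) (pderiv (some (Sum.inr j)) (G i)) * algebraMap ℂ K (c' j p) = 0)
    (hwind : AlgebraicIndependent ℂ w) (gn : Fin n ⊕ Fin n × Fin n → K)
    (hgl : ∀ i, gn (Sum.inl i) = w i) (hgr : ∀ i p, gn (Sum.inr (i, p)) = D p (w i)) :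
    (∀ i, w i ∈ IntermediateField.adjoin ℂ (Set.range gn)) ∧
      ∀ p, ∀ m ∈ IntermediateField.adjoin ℂ (Set.range gn),
        D p m ∈ IntermediateField.adjoin ℂ (Set.range gn) := by
  -- algebraicity over ℂ(x)
  have walg : ∀ i, IsAlgebraic (IntermediateField.adjoin ℂ (Set.range x)) (w i) := by
    intro i
    rw [← hezw i]
    refine isAlg_of_rel _ (ez i) ?_ (G i) (r0 i) (r1 i)
    rintro (j | j)
    · rw [hezx]; exact IntermediateField.subset_adjoin _ _ ⟨j, rfl⟩
    · rw [hezc]; exact IntermediateField.algebraMap_mem _ _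
  have dwalg : ∀ i p, IsAlgebraic (IntermediateField.adjoin ℂ (Set.range x))
      (D p (w i)) := by
    intro i p
    let S : IntermediateField ℂ K :=
      (algebraicClosure (IntermediateField.adjoin ℂ (Set.range x)) K).restrictScalars ℂ
    have hS : ∀ y, y ∈ S ↔ IsAlgebraic (IntermediateField.adjoin ℂ (Set.range x)) y :=
      fun y => mem_algebraicClosure_iff
    have hSe : ∀ o, ez i o ∈ S := by
      rintro (_ | j | j)
      · rw [hezw]; exact (hS _).2 (walg i)
      · rw [hezx]; exact (hS _).2 (isAlgebraic_algebraMap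
          (⟨x j, IntermediateField.subset_adjoin _ _ ⟨j, rfl⟩⟩ : IntermediateField.adjoin ℂ (Set.range x)))
      · rw [hezc]; exact S.algebraMap_mem _
    rw [← hS]
    have h1 : D p (w i) = -(∑ j, aeval (ez i) (pderiv (some (Sum.inr j)) (G i)) *
        algebraMap ℂ K (c' j p)) / aeval (ez i) (pderiv none (G i)) := by
      rw [eq_div_iff (r1 i), mul_comm]
      exact eq_neg_of_add_eq_zero_left (r2 i p)
    rw [h1]
    exact S.div_mem (S.neg_mem (S.sum_mem fun j _ => S.mul_mem (aeval_mem S _ hSe _)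
      (S.algebraMap_mem _))) (aeval_mem S _ hSe _)
  have dwalg' : ∀ i p, IsAlgebraic (IntermediateField.adjoin ℂ (Set.range w))
      (D p (w i)) := fun i p => exchange x w hwind walg _ (dwalg i p)
  -- the differential field
  let F : IntermediateField ℂ K := IntermediateField.adjoin ℂ (Set.range gn)
  have hwF : ∀ i, w i ∈ F := fun i => IntermediateField.subset_adjoin _ _ ⟨Sum.inl i, hgl i⟩
  have hdwF : ∀ i p, D p (w i) ∈ F :=
    fun i p => IntermediateField.subset_adjoin _ _ ⟨Sum.inr (i, p), hgr i p⟩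
  have hFalg : ∀ a ∈ F, IsAlgebraic (IntermediateField.adjoin ℂ (Set.range w)) a := by
    let S : IntermediateField ℂ K :=
      (algebraicClosure (IntermediateField.adjoin ℂ (Set.range w)) K).restrictScalars ℂ
    have hS : ∀ y, y ∈ S ↔ IsAlgebraic (IntermediateField.adjoin ℂ (Set.range w)) y :=
      fun y => mem_algebraicClosure_iff
    have hFS : F ≤ S := by
      refine IntermediateField.adjoin_le_iff.2 ?_
      rintro _ ⟨j | ⟨i, p⟩, rfl⟩
      · rw [hgl]; exact (hS _).2 (isAlgebraic_algebraMap
          (⟨w j, IntermediateField.subset_adjoin _ _ ⟨j, rfl⟩⟩ : IntermediateField.adjoin ℂ (Set.range w)))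
      · rw [hgr]; exact (hS _).2 (dwalg' i p)
    exact fun a ha => (hS a).1 (hFS ha)
  exact ⟨hwF, fun p m hm => deriv_closed _ w F hwF (fun i => hdwF i p) m hm (hFalg m hm)⟩

end AATAux

open AATAux

theorem aat_higher_derivatives_rational {n : ℕ} (hn : 1 ≤ n) (φ : Fin n → (Fin n → ℂ) → ℂ)
    (hmero : ∀ k, Mero (φ k)) (hindep : AnalyticallyIndep φ) (haat : AdmitsAAT φ)
    (k : Fin n) (L : List (Fin n)) (hL : 2 ≤ L.length) :
    ∃ A B : MvPolynomial (Fin n ⊕ Fin n × Fin n) ℂ,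
      (∃ u : Fin n → ℂ, (∀ j, AnalyticAt ℂ (φ j) u) ∧
        (∀ i q, AnalyticAt ℂ (pd (φ i) q) u) ∧
        eval (Sum.elim (fun j => φ j u) fun iq => pd (φ iq.1) iq.2 u) B ≠ 0) ∧
      ∀ u : Fin n → ℂ, (∀ j, AnalyticAt ℂ (φ j) u) →
        (∀ i q, AnalyticAt ℂ (pd (φ i) q) u) →
        AnalyticAt ℂ (pdIter (φ k) L) u →
        eval (Sum.elim (fun j => φ j u) fun iq => pd (φ iq.1) iq.2 u) B ≠ 0 →
        pdIter (φ k) L u =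
          eval (Sum.elim (fun j => φ j u) fun iq => pd (φ iq.1) iq.2 u) A /
            eval (Sum.elim (fun j => φ j u) fun iq => pd (φ iq.1) iq.2 u) B := by
  choose G hG using exists_G φ hmero hindep haat
  obtain ⟨b, hb⟩ := (Gen.all hG).slice
  have hsh : ∀ u : Fin n → ℂ, AnalyticAt ℂ (fun u => u + b) u :=
    fun u => analyticAt_id.add analyticAt_const
  have hrx : ∀ j, ∃ m, Rep m (φ j) := fun j =>
    exists_rep_comp (hmero j) (fun u => u) (fun u => analyticAt_id) Function.surjective_id
  have hrw : ∀ j, ∃ m, Rep m (fun u => φ j (u + b)) := fun j =>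
    exists_rep_comp (hmero j) _ hsh fun y => ⟨y - b, by simp⟩
  choose x hx using hrx
  choose w hw using hrw
  have hdw : ∀ j p, Rep (dP p (w j)) (fun u => pd (φ j) p (u + b)) := by
    intro j p
    have := (hw j).deriv (Pi.single p 1)
    simp only [fderiv_comp_add_right] at this
    exact this
  -- the specialised relation
  let ez : Fin n → Option (Fin n ⊕ Fin n) → Mer (Fin n → ℂ) := fun i o =>
    o.elim (w i) (Sum.elim x fun j => algebraMap ℂ (Mer (Fin n → ℂ)) (φ j b))
  have hez : ∀ i o, Rep (ez i o) (fun u => zf φ i o (u, b)) := by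
    rintro i (_ | j | j)
    · exact hw i
    · exact hx j
    · exact Rep.const _
  have r0 : ∀ i, aeval (ez i) (G i) = 0 := fun i =>
    (Rep.poly (hez i) (G i)).eq_zero (hb.mono fun u hu => (hu i).1)
  have r1 : ∀ i, aeval (ez i) (pderiv none (G i)) ≠ 0 := by
    intro i h0
    have h1 := Rep.poly (hez i) (pderiv none (G i))
    rw [h0] at h1
    obtain ⟨u, hu, hu'⟩ := (h1.gen_zero.and hb).exists
    exact (hu' i).2.1 hu
  have r2 : ∀ i p, aeval (ez i) (pderiv none (G i)) * dP p (w i) +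
      ∑ j, aeval (ez i) (pderiv (some (Sum.inr j)) (G i)) *
        algebraMap ℂ (Mer (Fin n → ℂ)) (pd (φ j) p b) = 0 := by
    intro i p
    refine (((Rep.poly (hez i) (pderiv none (G i))).mul (hdw i p)).add (Rep.sum Finset.univ fun j =>
      (Rep.poly (hez i) (pderiv (some (Sum.inr j)) (G i))).mul (Rep.const (pd (φ j) p b)))).eq_zero ?_
    exact hb.mono fun u hu => (hu i).2.2 p
  -- algebraic independence of w
  have hwind : AlgebraicIndependent ℂ w := by
    obtain ⟨u0, ha, hd⟩ := hindep
    have ho := open_of_jac ha hd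
    have hcancel : u0 - b + b = u0 := sub_add_cancel u0 b
    refine algIndep_of_open hw (u0 - b) (fun i => ?_) ?_
    · exact AnalyticAt.fun_comp (g := φ i) (by rw [hcancel]; exact ha i) (hsh _)
    · rw [hcancel]
      refine ho.trans ?_
      have hmap : Filter.map (fun u => u + b) (nhds (u0 - b)) = nhds u0 := by
        have := (Homeomorph.addRight b).map_nhds_eq (u0 - b)
        simpa using this
      rw [← hmap, Filter.map_map]
      exact le_rfl
  let gn : Fin n ⊕ Fin n × Fin n → Mer (Fin n → ℂ) :=
    Sum.elim w fun iq => dP iq.2 (w iq.1)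
  obtain ⟨hwF, hDF⟩ := core dP x w (fun j => φ j b) (fun j p => pd (φ j) p b) ez (fun _ => rfl)
    (fun _ _ => rfl) (fun _ _ => rfl) G r0 r1 r2 hwind gn (fun _ => rfl) (fun _ _ => rfl)
  have hiter : ∀ L : List (Fin n), ∃ m ∈ IntermediateField.adjoin ℂ (Set.range gn), Rep m (pdIter (fun u => φ k (u + b)) L) := by
    intro L
    induction L with
    | nil => exact ⟨w k, hwF k, hw k⟩
    | cons p L ih =>
      obtain ⟨m, hm, hr⟩ := ih
      exact ⟨dP p m, hDF p m hm,
        hr.deriv (Pi.single p 1)⟩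
  obtain ⟨m, hmF, hmr⟩ := hiter L
  obtain ⟨A, B, hB, hAB⟩ : ∃ A B : MvPolynomial (Fin n ⊕ Fin n × Fin n) ℂ,
      aeval gn B ≠ 0 ∧ m * aeval gn B = aeval gn A := by
    obtain ⟨A, B, h⟩ := (IntermediateField.mem_adjoin_range_iff ℂ gn m).1 hmF
    by_cases hB : aeval gn B = 0
    · exact ⟨0, 1, by simp, by simp [h, hB]⟩
    · exact ⟨A, B, hB, by rw [h, div_mul_cancel₀ _ hB]⟩
  let vf : Fin n ⊕ Fin n × Fin n → (Fin n → ℂ) → ℂ :=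
    Sum.elim φ fun iq => pd (φ iq.1) iq.2
  have hvf : ∀ u, (Sum.elim (fun j => φ j u) fun iq => pd (φ iq.1) iq.2 u) = fun i => vf i u := by
    intro u
    funext i
    rcases i with j | iq <;> rfl
  have hgn : ∀ i, Rep (gn i) (fun u => vf i (u + b)) := by
    rintro (j | iq)
    · exact hw j
    · exact hdw iq.1 iq.2
  simp only [hvf]
  refine ⟨A, B, ?_, ?_⟩
  · obtain ⟨u, h1, h2⟩ := ((Rep.poly hgn B).gen_ne hB |>.and
      (Gen.comp (Gen.all fun j => (hx j).analytic) _ hsh fun y => ⟨y - b, by simp⟩)).exists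
    exact ⟨u + b, h2, fun i q => pd_analytic (h2 i) q, h1⟩
  · intro u ha hda hLa hBne
    rw [eq_div_iff hBne]
    have hrep := ((hmr.mul (Rep.poly hgn B)).add ((Rep.const (-1)).mul (Rep.poly hgn A)))
    have hz : m * aeval gn B + algebraMap ℂ (Mer (Fin n → ℂ)) (-1) * aeval gn A = 0 := by
      rw [hAB]; simp
    rw [hz] at hrep
    have hv : ∀ i, AnalyticAt ℂ (vf i) u := by
      rintro (j | iq)
      · exact ha j
      · exact hda iq.1 iq.2
    have hpc : ∀ P : MvPolynomial (Fin n ⊕ Fin n × Fin n) ℂ,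
        ContinuousAt (fun v => eval (fun i => vf i v) P) u := fun P =>
      ContinuousAt.comp (g := fun z : Fin n ⊕ Fin n × Fin n → ℂ => eval z P) (f := fun v i => vf i v)
        (MvPolynomial.continuous_eval P).continuousAt
        (continuousAt_pi.2 fun i => (hv i).continuousAt)
    have hcont : ContinuousAt (fun v => pdIter (φ k) L v * eval (fun i => vf i v) B +
        (-1) * eval (fun i => vf i v) A) u :=
      (hLa.continuousAt.mul (hpc B)).add (continuousAt_const.mul (hpc A))
    have hgz : Gen (fun v => pdIter (φ k) L v * eval (fun i => vf i v) B +
        (-1) * eval (fun i => vf i v) A = 0) := by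
      have := hrep.gen_zero.comp (fun v => v - b) (fun v => analyticAt_id.sub analyticAt_const)
        fun y => ⟨y + b, by simp⟩
      simpa only [pdIter_shift, sub_add_cancel] using this
    have := hgz.eq_zero hcont
    linear_combination this
end

section
/- Sufficient condition for periodicity: suppose the meromorphic mapping Φ = (φ₁,…,φ_n) admits an algebraic addition theorem, and for each k, p ∈ {1,…,n} let P_{kp} ∈ ℂ[z₀, z₁,…,z_n] be a nonzero polynomial with P_{kp}(∂φ_k/∂u_p(u); φ₁(u),…,φ_n(u)) = 0 identically. Suppose a, b ∈ ℂⁿ are distinct points at which every φ_k is analytic, such that Φ(a) = Φ(b), ∂φ_k/∂u_p(a) = ∂φ_k/∂u_p(b) for all k, p, and such that ∂P_{kp}/∂z₀ evaluated at (∂φ_k/∂u_p(a); φ₁(a),…,φ_n(a)) is nonzero for every k, p. Then p := a − b is a period of Φ: for every k, φ_k(u + a − b) = φ_k(u) for every u at which both sides are analytic. -/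
open MvPolynomial

open Filter Topology

/-- Strict derivative of the evaluation of a multivariate polynomial. -/
theorem aux_poly_deriv {σ : Type*} [Fintype σ] (P : MvPolynomial σ ℂ) (x : σ → ℂ) :
    ∃ L : (σ → ℂ) →L[ℂ] ℂ, HasStrictFDerivAt (fun y : σ → ℂ => eval y P) L x ∧
      ∀ v, L v = ∑ i, eval x (pderiv i P) * v i := by
  classical
  induction P using MvPolynomial.induction_on with
  | C c =>
    refine ⟨0, ?_, fun v => by simp⟩
    simpa using! hasStrictFDerivAt_const (𝕜 := ℂ) c x
  | add p q hp hq =>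
    obtain ⟨L, hL, hL'⟩ := hp
    obtain ⟨M, hM, hM'⟩ := hq
    refine ⟨L + M, ?_, fun v => ?_⟩
    · simp only [map_add]
      exact hL.add hM
    · simp [hL', hM', add_mul, Finset.sum_add_distrib]
  | mul_X p j hp =>
    obtain ⟨L, hL, hL'⟩ := hp
    have hX : HasStrictFDerivAt (fun y : σ → ℂ => y j)
        (ContinuousLinearMap.proj j : (σ → ℂ) →L[ℂ] ℂ) x :=
      (ContinuousLinearMap.proj j : (σ → ℂ) →L[ℂ] ℂ).hasStrictFDerivAt
    refine ⟨eval x p • (ContinuousLinearMap.proj j : (σ → ℂ) →L[ℂ] ℂ) + x j • L, ?_, fun v => ?_⟩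
    · simp only [map_mul, eval_X]
      exact hL.mul hX
    · have e : ∀ i, eval x (pderiv i (p * X j)) * v i
          = (if i = j then eval x p * v i else 0) + x j * (eval x (pderiv i p) * v i) := by
        intro i
        by_cases hij : i = j
        · subst hij
          simp [Derivation.leibniz]
          ring
        · simp [Derivation.leibniz, pderiv_X_of_ne (Ne.symm hij), hij]
          ring
      simp only [e, Finset.sum_add_distrib, ← Finset.mul_sum, ← hL']
      simp

/-- Simple root: two zeros close to the base point differ in the `none` coordinate by at most a
multiple of the difference in the other coordinates. -/
theorem aux_lip {n : ℕ} (P : MvPolynomial (Option (Fin n)) ℂ) (x0 : Option (Fin n) → ℂ)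
    (h0 : eval x0 (pderiv none P) ≠ 0) :
    ∃ K : ℝ, 0 ≤ K ∧ ∀ᶠ q : (Option (Fin n) → ℂ) × (Option (Fin n) → ℂ) in 𝓝 (x0, x0),
      eval q.1 P = 0 → eval q.2 P = 0 →
        ‖q.1 none - q.2 none‖ ≤ K * ‖fun j => q.1 (some j) - q.2 (some j)‖ := by
  obtain ⟨d, hd⟩ : ∃ d, d = eval x0 (pderiv none P) := ⟨_, rfl⟩
  rw [← hd] at h0
  have hdpos : 0 < ‖d‖ := norm_pos_iff.2 h0
  obtain ⟨C, hC⟩ : ∃ C : ℝ, C = ∑ j : Fin n, ‖eval x0 (pderiv (some j) P)‖ := ⟨_, rfl⟩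
  have hC0 : 0 ≤ C := hC ▸ Finset.sum_nonneg fun _ _ => norm_nonneg _
  obtain ⟨L, hL1, hL2⟩ := aux_poly_deriv P x0
  have hb := hL1.isLittleO.bound (half_pos hdpos)
  refine ⟨(C + ‖d‖ / 2) / (‖d‖ / 2), by positivity, ?_⟩
  filter_upwards [hb] with q hq h1 h2
  rw [div_mul_eq_mul_div, le_div_iff₀ (by positivity)]
  set s := q.1 none - q.2 none with hs
  set w : Fin n → ℂ := fun j => q.1 (some j) - q.2 (some j) with hw
  have hN : ‖q.1 - q.2‖ ≤ ‖s‖ + ‖w‖ := by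
    refine (pi_norm_le_iff_of_nonneg (by positivity)).2 fun i => ?_
    cases i with
    | none => simpa [hs] using norm_nonneg w
    | some j =>
      have := norm_le_pi_norm w j
      simp only [hw] at this ⊢
      simp only [Pi.sub_apply]
      linarith [norm_nonneg s]
  have hS : ‖∑ j : Fin n, eval x0 (pderiv (some j) P) * w j‖ ≤ C * ‖w‖ := by
    rw [hC, Finset.sum_mul]
    refine norm_sum_le_of_le _ fun j _ => ?_
    rw [norm_mul]
    exact mul_le_mul_of_nonneg_left (norm_le_pi_norm w j) (norm_nonneg _)
  have hL : ‖d * s + ∑ j : Fin n, eval x0 (pderiv (some j) P) * w j‖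
      ≤ ‖d‖ / 2 * (‖s‖ + ‖w‖) := by
    refine le_trans (le_of_eq ?_) (hq.trans (mul_le_mul_of_nonneg_left hN (by positivity)))
    rw [h1, h2, sub_zero, zero_sub, norm_neg]
    rw [hL2, Fintype.sum_option, hd]
    rfl
  have hT : ‖d‖ * ‖s‖ ≤ ‖d * s + ∑ j : Fin n, eval x0 (pderiv (some j) P) * w j‖
      + ‖∑ j : Fin n, eval x0 (pderiv (some j) P) * w j‖ := by
    rw [← norm_mul]
    simpa using norm_sub_le (d * s + ∑ j : Fin n, eval x0 (pderiv (some j) P) * w j)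
      (∑ j : Fin n, eval x0 (pderiv (some j) P) * w j)
  nlinarith

/-- A function with `‖f'‖ ≤ K ‖f‖` near zero vanishing at zero vanishes near zero. -/
theorem aux_gronwall {n : ℕ} (f : (Fin n → ℂ) → (Fin n → ℂ)) (K : ℝ)
    (f' : (Fin n → ℂ) → ((Fin n → ℂ) →L[ℂ] (Fin n → ℂ)))
    (h : ∀ᶠ v in 𝓝 0, HasFDerivAt f (f' v) v ∧ ‖f' v‖ ≤ K * ‖f v‖) (h0 : f 0 = 0) :
    ∀ᶠ v in 𝓝 0, f v = 0 := by
  obtain ⟨r, hr, hball⟩ := Metric.eventually_nhds_iff_ball.1 h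
  refine Metric.eventually_nhds_iff_ball.2 ⟨r, hr, fun v hv => ?_⟩
  have hmem : ∀ t ∈ Set.Icc (0:ℝ) 1, (t : ℂ) • v ∈ Metric.ball (0 : Fin n → ℂ) r := by
    intro t ht
    rw [mem_ball_zero_iff] at hv ⊢
    rw [norm_smul, Complex.norm_real, Real.norm_of_nonneg ht.1]
    nlinarith [norm_nonneg v, ht.2]
  have hderiv : ∀ t ∈ Set.Icc (0:ℝ) 1,
      HasDerivAt (fun t : ℝ => f ((t : ℂ) • v)) (f' ((t : ℂ) • v) v) t := by
    intro t ht
    have hl : HasDerivAt (fun z : ℝ => (z : ℂ) • v) v t := by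
      simpa using (Complex.ofRealCLM.hasDerivAt (x := t)).smul_const v
    exact HasFDerivAt.comp_hasDerivAt (𝕜 := ℝ) t (l := f)
      (l' := (f' ((t : ℂ) • v)).restrictScalars ℝ)
      (f := fun z : ℝ => (z : ℂ) • v) (f' := v) ((hball _ (hmem t ht)).1.restrictScalars ℝ) hl
  have := eq_zero_of_abs_deriv_le_mul_abs_self_of_eq_zero_right (K := K * ‖v‖)
    (f := fun t : ℝ => f ((t : ℂ) • v)) (f' := fun t : ℝ => f' ((t : ℂ) • v) v) (a := 0) (b := 1)
    (fun t ht => (hderiv t ht).continuousAt.continuousWithinAt)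
    (fun t ht => (hderiv t ⟨ht.1, ht.2.le⟩).hasDerivWithinAt)
    (by simp [h0])
    (fun t ht => by
      have hb := (hball _ (hmem t ⟨ht.1, ht.2.le⟩)).2
      refine ((f' ((t : ℂ) • v)).le_opNorm v).trans ?_
      calc _ ≤ (K * ‖f ((t : ℂ) • v)‖) * ‖v‖ := mul_le_mul_of_nonneg_right hb (norm_nonneg _)
        _ = _ := by ring)
    1 ⟨zero_le_one, le_rfl⟩
  simpa using this

theorem aux_entire {n : ℕ} {F : (Fin n → ℂ) → ℂ} (hF : ∀ u, AnalyticAt ℂ F u) {b : Fin n → ℂ}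
    (h : ∀ᶠ u in 𝓝 b, F u = 0) (u : Fin n → ℂ) : F u = 0 :=
  AnalyticOnNhd.eqOn_zero_of_preconnected_of_eventuallyEq_zero (U := Set.univ)
    (fun x _ => hF x) isPreconnected_univ (Set.mem_univ b) h (Set.mem_univ u)

/-- Local periodicity of a meromorphic function implies global periodicity. -/
theorem aux_global {n : ℕ} {f : (Fin n → ℂ) → ℂ} (hf : Mero f) (c b : Fin n → ℂ)
    (hloc : ∀ᶠ u in 𝓝 b, f (u + c) = f u) (u : Fin n → ℂ) (h1 : AnalyticAt ℂ f (u + c))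
    (h2 : AnalyticAt ℂ f u) : f (u + c) = f u := by
  obtain ⟨g, h, hg, hh, ⟨x0, hx0⟩, hq⟩ := hf
  have hsh : ∀ x, AnalyticAt ℂ (fun y : Fin n → ℂ => y + c) x := fun x =>
    analyticAt_id.add analyticAt_const
  have hgc : ∀ x, AnalyticAt ℂ (fun y => g (y + c)) x := fun x =>
    AnalyticAt.fun_comp (hg (x + c)) (hsh x)
  have hhc : ∀ x, AnalyticAt ℂ (fun y => h (y + c)) x := fun x =>
    AnalyticAt.fun_comp (hh (x + c)) (hsh x)
  have hE : ∀ x, (g (x + c) * h x - g x * h (x + c)) * (h x * h (x + c)) = 0 := by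
    refine aux_entire (b := b) (fun x => ?_) ?_
    · exact (((hgc x).mul (hh x)).sub ((hg x).mul (hhc x))).mul ((hh x).mul (hhc x))
    · filter_upwards [hloc] with x hx
      by_cases hx1 : h x = 0
      · simp [hx1]
      by_cases hx2 : h (x + c) = 0
      · simp [hx2]
      rw [hq _ hx1, hq _ hx2, div_eq_div_iff hx2 hx1] at hx
      rw [hx, sub_self, zero_mul]
  have hfreq : ∃ᶠ x in 𝓝 u, h x * h (x + c) ≠ 0 := by
    intro hev
    have hz : ∀ x, h x * h (x + c) = 0 :=
      aux_entire (b := u) (fun x => (hh x).mul (hhc x)) (hev.mono fun x hx => not_not.1 hx)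
    have hz2 := aux_entire (b := x0) hhc (((hh x0).continuousAt.eventually_ne hx0).mono
      fun x hx => (mul_eq_zero.1 (hz x)).resolve_left hx) (x0 - c)
    simp at hz2
    exact hx0 hz2
  by_contra hne
  have hc1 : ContinuousAt (fun x => f (x + c)) u :=
    (AnalyticAt.fun_comp (f := fun y => y + c) h1 (hsh u)).continuousAt
  have hD : ∀ᶠ x in 𝓝 u, f (x + c) - f x ≠ 0 :=
    (hc1.sub h2.continuousAt).eventually_ne (sub_ne_zero.2 hne)
  obtain ⟨x, hx, hx'⟩ := (hfreq.and_eventually hD).exists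
  have hx1 := left_ne_zero_of_mul hx
  have hx2 := right_ne_zero_of_mul hx
  apply hx'
  rw [hq _ hx1, hq _ hx2, sub_eq_zero, div_eq_div_iff hx2 hx1]
  exact sub_eq_zero.1 ((mul_eq_zero.1 (hE x)).resolve_right hx)

theorem aux_pd_analytic {n : ℕ} {f : (Fin n → ℂ) → ℂ} {u : Fin n → ℂ} (h : AnalyticAt ℂ f u)
    (p : Fin n) : AnalyticAt ℂ (pd f p) u :=
  ((ContinuousLinearMap.apply ℂ ℂ (Pi.single p 1 : Fin n → ℂ)).analyticAt _).fun_comp h.fderiv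

theorem aux_fderiv_bound {n : ℕ} (L : (Fin n → ℂ) →L[ℂ] ℂ) :
    ‖L‖ ≤ ∑ p, ‖L (Pi.single p 1)‖ := by
  refine L.opNorm_le_bound (Finset.sum_nonneg fun _ _ => norm_nonneg _) fun v => ?_
  have : L v = ∑ p, v p * L (Pi.single p 1) := by
    conv_lhs => rw [pi_eq_sum_univ' v]
    simp [map_sum]
  rw [this, Finset.sum_mul]
  refine norm_sum_le_of_le _ fun p _ => ?_
  rw [norm_mul, mul_comm]
  exact mul_le_mul_of_nonneg_left (norm_le_pi_norm v p) (norm_nonneg _)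

theorem aat_sufficient_condition_periodicity {n : ℕ} (hn : 1 ≤ n) (φ : Fin n → (Fin n → ℂ) → ℂ)
    (hmero : ∀ k, Mero (φ k)) (hindep : AnalyticallyIndep φ) (haat : AdmitsAAT φ)
    (P : Fin n → Fin n → MvPolynomial (Option (Fin n)) ℂ)
    (hP0 : ∀ k p, P k p ≠ 0)
    (hPid : ∀ k p (u : Fin n → ℂ), (∀ j, AnalyticAt ℂ (φ j) u) →
      (∀ j q, AnalyticAt ℂ (pd (φ j) q) u) →
      eval (fun i => i.elim (pd (φ k) p u) fun j => φ j u) (P k p) = 0)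
    (a b : Fin n → ℂ) (hab : a ≠ b)
    (ha : ∀ k, AnalyticAt ℂ (φ k) a) (hb : ∀ k, AnalyticAt ℂ (φ k) b)
    (hval : ∀ k, φ k a = φ k b)
    (hder : ∀ k p, pd (φ k) p a = pd (φ k) p b)
    (hPz0 : ∀ k p, eval (fun i => i.elim (pd (φ k) p a) fun j => φ j a)
      (MvPolynomial.pderiv none (P k p)) ≠ 0) :
    ∀ (k : Fin n) (u : Fin n → ℂ), AnalyticAt ℂ (φ k) (u + (a - b)) →
      AnalyticAt ℂ (φ k) u → φ k (u + (a - b)) = φ k u := by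
  -- local equality near the base points
  have hta : Tendsto (fun v : Fin n → ℂ => a + v) (𝓝 0) (𝓝 a) := by
    have : Continuous fun v : Fin n → ℂ => a + v := by fun_prop
    simpa using this.tendsto 0
  have htb : Tendsto (fun v : Fin n → ℂ => b + v) (𝓝 0) (𝓝 b) := by
    have : Continuous fun v : Fin n → ℂ => b + v := by fun_prop
    simpa using this.tendsto 0
  have hAa : ∀ᶠ v in 𝓝 (0 : Fin n → ℂ), ∀ k, AnalyticAt ℂ (φ k) (a + v) :=
    hta.eventually (eventually_all.2 fun k => (ha k).eventually_analyticAt)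
  have hAb : ∀ᶠ v in 𝓝 (0 : Fin n → ℂ), ∀ k, AnalyticAt ℂ (φ k) (b + v) :=
    htb.eventually (eventually_all.2 fun k => (hb k).eventually_analyticAt)
  have hK : ∀ k p, ∃ K : ℝ, 0 ≤ K ∧ ∀ᶠ v in 𝓝 (0 : Fin n → ℂ),
      ‖pd (φ k) p (a + v) - pd (φ k) p (b + v)‖
        ≤ K * ‖fun j => φ j (a + v) - φ j (b + v)‖ := by
    intro k p
    obtain ⟨K, hK0, hK⟩ := aux_lip (P k p) _ (hPz0 k p)
    refine ⟨K, hK0, ?_⟩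
    have hc : ∀ c : Fin n → ℂ, (∀ k, AnalyticAt ℂ (φ k) c) →
        ContinuousAt (fun u => (fun i : Option (Fin n) =>
          i.elim (pd (φ k) p u) fun j => φ j u)) c := by
      intro c hc
      refine continuousAt_pi.2 fun i => ?_
      cases i with
      | none => exact (aux_pd_analytic (hc k) p).continuousAt
      | some j => exact (hc j).continuousAt
    have t1 := (hc a ha).tendsto.comp hta
    have t2 := (hc b hb).tendsto.comp htb
    have heq : (fun i : Option (Fin n) => i.elim (pd (φ k) p b) fun j => φ j b)
        = fun i : Option (Fin n) => i.elim (pd (φ k) p a) fun j => φ j a := by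
      funext i
      cases i with
      | none => exact (hder k p).symm
      | some j => exact (hval j).symm
    rw [heq] at t2
    filter_upwards [(t1.prodMk_nhds t2).eventually hK, hAa, hAb] with v hv hva hvb
    exact hv (hPid k p _ hva fun j q => aux_pd_analytic (hva j) q)
      (hPid k p _ hvb fun j q => aux_pd_analytic (hvb j) q)
  choose K hK0 hK using hK
  have hKall := eventually_all.2 fun k => eventually_all.2 fun p => hK k p
  have hloc := aux_gronwall (fun v j => φ j (a + v) - φ j (b + v)) (∑ k, ∑ p, K k p)
    (fun v => ContinuousLinearMap.pi fun j => fderiv ℂ (φ j) (a + v) - fderiv ℂ (φ j) (b + v))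
    (by
      filter_upwards [hKall, hAa, hAb] with v hv hva hvb
      constructor
      · refine hasFDerivAt_pi.2 fun j => ?_
        have e1 := (hva j).differentiableAt.hasFDerivAt.comp v ((hasFDerivAt_id v).const_add a)
        have e2 := (hvb j).differentiableAt.hasFDerivAt.comp v ((hasFDerivAt_id v).const_add b)
        simpa using! e1.sub e2
      · refine ContinuousLinearMap.opNorm_le_bound _ (mul_nonneg (Finset.sum_nonneg fun k _ =>
          Finset.sum_nonneg fun p _ => hK0 k p) (norm_nonneg _)) fun w => ?_
        refine (pi_norm_le_iff_of_nonneg (mul_nonneg (mul_nonneg (Finset.sum_nonneg fun k _ =>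
          Finset.sum_nonneg fun p _ => hK0 k p) (norm_nonneg _)) (norm_nonneg _))).2 fun j => ?_
        refine (ContinuousLinearMap.le_opNorm
          (fderiv ℂ (φ j) (a + v) - fderiv ℂ (φ j) (b + v)) w).trans ?_
        refine mul_le_mul_of_nonneg_right ?_ (norm_nonneg _)
        refine (aux_fderiv_bound _).trans ?_
        calc _ ≤ ∑ p, K j p * ‖fun j => φ j (a + v) - φ j (b + v)‖ :=
              Finset.sum_le_sum fun p _ => hv j p
          _ = (∑ p, K j p) * ‖fun j => φ j (a + v) - φ j (b + v)‖ := by rw [Finset.sum_mul]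
          _ ≤ _ := mul_le_mul_of_nonneg_right
              (Finset.single_le_sum (f := fun k => ∑ p, K k p)
                (fun k _ => Finset.sum_nonneg fun p _ => hK0 k p) (Finset.mem_univ j))
              (norm_nonneg _))
    (by funext j; simp [hval j])
  intro k u h1 h2
  refine aux_global (hmero k) (a - b) b ?_ u h1 h2
  have ht : Tendsto (fun x : Fin n → ℂ => x - b) (𝓝 b) (𝓝 0) := by
    have : Continuous fun x : Fin n → ℂ => x - b := by fun_prop
    simpa using this.tendsto b
  filter_upwards [ht.eventually hloc] with x hx
  have := congrFun hx k
  simp only [Pi.zero_apply, sub_eq_zero] at this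
  rw [show x + (a - b) = a + (x - b) by abel, this]
  congr 1
  abel
end

section
/- Suppose the meromorphic mapping Φ = (φ₁,…,φ_n) admits an algebraic addition theorem, let θ be a primitive element as described, and let h be the degree of V in the variable t. Then there exists an integer r such that: for every j ∈ {1,…,n}, every k ∈ {0, 1,…,h}, and every b ∈ ℂⁿ at which all φ_i are analytic, there is a nonzero polynomial W ∈ ℂ[t, x₁,…,x_n] of total degree at most r with W(φ_j(u+b)·θ(u)^{h−k}; φ₁(u),…,φ_n(u)) = 0 for every u at which all the functions involved are analytic; the bound r does not depend on b, j or k. -/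
open MvPolynomial

/-- Elimination: a nonzero polynomial annihilating `lam * t ^ m`, given annihilating polynomials of
`lam` and of `t`. -/
lemma elim_mul_pow {σ : Type} (G V : MvPolynomial (Option σ) ℂ) (hG : G ≠ 0) (hV : V ≠ 0)
    (m : ℕ) : ∃ W : MvPolynomial (Option σ) ℂ, W ≠ 0 ∧ ∀ (x : σ → ℂ) (lam t : ℂ),
      eval (fun i => i.elim lam x) G = 0 → eval (fun i => i.elim t x) V = 0 →
      eval (fun i => i.elim (lam * t ^ m) x) W = 0 := by
  classical
  let T : Type := {p : (σ → ℂ) × ℂ × ℂ // eval (fun i => Option.elim i p.2.1 p.1) G = 0 ∧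
    eval (fun i => Option.elim i p.2.2 p.1) V = 0}
  let ev : MvPolynomial σ ℂ →+* (T → ℂ) := RingHom.pi fun p => eval p.1.1
  let _ : Algebra (MvPolynomial σ ℂ) (T → ℂ) := ev.toAlgebra
  let g := optionEquivLeft ℂ σ G
  let v := optionEquivLeft ℂ σ V
  have hg0 : g ≠ 0 := by simpa [g] using hG
  have hv0 : v ≠ 0 := by simpa [v] using hV
  let L : T → ℂ := fun p => p.1.2.1
  let τ : T → ℂ := fun p => p.1.2.2
  have key : ∀ (f : Polynomial (MvPolynomial σ ℂ)) (y : T → ℂ) (p : T),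
      (Polynomial.aeval y f) p = Polynomial.eval (y p) (f.map (eval p.1.1)) := by
    intro f y p
    rw [Polynomial.aeval_def, Polynomial.eval_map]
    change (Pi.evalRingHom (fun _ : T => ℂ) p) _ = _
    rw [Polynomial.hom_eval₂]
    rfl
  have hgL : Polynomial.aeval L g = 0 := by
    funext p
    rw [key]
    have := p.2.1
    rw [optionEquivLeft_elim_eval] at this
    exact this
  have hvt : Polynomial.aeval τ v = 0 := by
    funext p
    rw [key]
    have := p.2.2
    rw [optionEquivLeft_elim_eval] at this
    exact this
  have h1 := isIntegral_leadingCoeff_smul g L hgL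
  have h2 := isIntegral_leadingCoeff_smul v τ hvt
  obtain ⟨P, hPm, hP⟩ := h1.mul (h2.pow m)
  let c : MvPolynomial σ ℂ := g.leadingCoeff * v.leadingCoeff ^ m
  have hc : c ≠ 0 := mul_ne_zero (by simpa using hg0) (pow_ne_zero _ (by simpa using hv0))
  refine ⟨(optionEquivLeft ℂ σ).symm (P.comp (Polynomial.C c * Polynomial.X)), ?_, ?_⟩
  · simp only [ne_eq, EmbeddingLike.map_eq_zero_iff]
    rw [Polynomial.comp_C_mul_X_eq_zero_iff (mem_nonZeroDivisors_of_ne_zero hc)]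
    exact hPm.ne_zero
  · intro x lam t hl ht
    rw [optionEquivLeft_elim_eval, AlgEquiv.apply_symm_apply]
    let p : T := ⟨(x, lam, t), hl, ht⟩
    have h3 : (Polynomial.aeval (g.leadingCoeff • L * (v.leadingCoeff • τ) ^ m) P) p = 0 := by
      rw [Polynomial.aeval_def, hP]; rfl
    rw [key] at h3
    have h4 : (g.leadingCoeff • L * (v.leadingCoeff • τ) ^ m) p
        = eval x c * (lam * t ^ m) := by
      have e1 : (g.leadingCoeff • L) p = eval x g.leadingCoeff * lam := by
        rw [Algebra.smul_def]; rfl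
      have e2 : (v.leadingCoeff • τ) p = eval x v.leadingCoeff * t := by
        rw [Algebra.smul_def]; rfl
      rw [Pi.mul_apply, Pi.pow_apply, e1, e2]
      simp only [c, map_mul, map_pow]
      ring
    rw [h4] at h3
    simpa [Polynomial.map_comp, Polynomial.eval_comp] using h3

/-- A nonzero entire function is nonzero on a dense set. -/
lemma dense_ne_zero {n : ℕ} (h : (Fin n → ℂ) → ℂ) (ha : ∀ u, AnalyticAt ℂ h u)
    (hne : ∃ u, h u ≠ 0) : Dense {u | h u ≠ 0} := by
  intro x
  by_contra hx
  rw [mem_closure_iff_frequently, Filter.not_frequently] at hx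
  obtain ⟨u, hu⟩ := hne
  apply hu
  have := AnalyticOnNhd.eqOn_zero_of_preconnected_of_eventuallyEq_zero (U := Set.univ)
    (fun z _ => ha z) isPreconnected_univ (Set.mem_univ x)
    (by filter_upwards [hx] with y hy; simpa using hy)
  exact this (Set.mem_univ u)

/-- Algebraic independence, locally at every point of analyticity. -/
lemma frequently_ne_zero {n : ℕ} (φ : Fin n → (Fin n → ℂ) → ℂ)
    (hmero : ∀ k, Mero (φ k)) (hindep : AnalyticallyIndep φ)
    (c : MvPolynomial (Fin n) ℂ) (hc : c ≠ 0) (b : Fin n → ℂ) (hb : ∀ i, AnalyticAt ℂ (φ i) b) :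
    ∃ᶠ b' in nhds b, eval (fun i => φ i b') c ≠ 0 := by
  classical
  intro hev
  simp only [not_not] at hev
  apply hc
  choose g h hg hh hne hgh using hmero
  let D : Set (Fin n → ℂ) := ⋂ i, {u | h i u ≠ 0}
  have hD : Dense D := by
    apply dense_iInter_of_isOpen
    · intro i
      have : Continuous (h i) := continuous_iff_continuousAt.2 fun u => (hh i u).continuousAt
      exact isOpen_ne_fun this continuous_const
    · intro i
      exact dense_ne_zero (h i) (hh i) (hne i)
  -- a function continuous at x vanishing on D near x vanishes at x
  have hclos : ∀ (f : (Fin n → ℂ) → ℂ) (x : Fin n → ℂ), ContinuousAt f x →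
      (∀ᶠ y in nhds x, y ∈ D → f y = 0) → f x = 0 := by
    intro f x hf hy
    by_contra hfx
    have h1 : ∃ᶠ y in nhds x, y ∈ D := mem_closure_iff_frequently.1 (hD x)
    obtain ⟨y, hyD, hy0, hy1⟩ := (h1.and_eventually (hy.and (hf.eventually_ne hfx))).exists
    exact hy1 (hy0 hyD)
  let F : (Fin n → ℂ) → ℂ := fun u =>
    ∑ m ∈ c.support, coeff m c * ∏ i, (g i u ^ m i * h i u ^ (c.totalDegree - m i))
  have hFa : ∀ u, AnalyticAt ℂ F u := by
    intro u
    apply Finset.analyticAt_fun_sum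
    intro m _
    apply analyticAt_const.mul
    apply Finset.analyticAt_fun_prod
    intro i _
    exact ((hg i u).pow _).mul ((hh i u).pow _)
  have hFD : ∀ u ∈ D, F u = (∏ i, h i u ^ c.totalDegree) * eval (fun i => φ i u) c := by
    intro u hu
    have hu' : ∀ i, h i u ≠ 0 := by simpa [D] using hu
    rw [eval_eq', Finset.mul_sum]
    apply Finset.sum_congr rfl
    intro m hm
    rw [mul_left_comm, ← Finset.prod_mul_distrib]
    congr 1
    apply Finset.prod_congr rfl
    intro i _
    have hle : m i ≤ c.totalDegree :=
      (monomial_le_degreeOf i hm).trans (degreeOf_le_totalDegree c i)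
    rw [hgh i u (hu' i), div_pow, ← pow_sub_mul_pow _ hle]
    have := hu' i
    field_simp
  have hF0 : ∀ u, F u = 0 := by
    intro u
    refine AnalyticOnNhd.eqOn_zero_of_preconnected_of_eventuallyEq_zero (U := Set.univ)
      (fun z _ => hFa z) isPreconnected_univ (Set.mem_univ b) ?_ (Set.mem_univ u)
    filter_upwards [hev.eventually_nhds] with x hx
    apply hclos F x (hFa x).continuousAt
    filter_upwards [hx] with y hy hyD
    rw [hFD y hyD, hy, mul_zero]
  have hcD : ∀ u ∈ D, eval (fun i => φ i u) c = 0 := by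
    intro u hu
    have hu' : ∀ i, h i u ≠ 0 := by simpa [D] using hu
    have := hFD u hu
    rw [hF0] at this
    exact (mul_eq_zero.1 this.symm).resolve_left
      (Finset.prod_ne_zero_iff.2 fun i _ => pow_ne_zero _ (hu' i))
  obtain ⟨u₀, hu₀, hdet⟩ := hindep
  let Φ : (Fin n → ℂ) → (Fin n → ℂ) := fun u i => φ i u
  have hnear : ∀ᶠ u in nhds u₀, eval (Φ u) c = 0 := by
    have hall : ∀ᶠ u in nhds u₀, ∀ i, AnalyticAt ℂ (φ i) u :=
      Filter.eventually_all.2 fun i => (hu₀ i).eventually_analyticAt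
    filter_upwards [hall] with u hu
    apply hclos (fun u => eval (Φ u) c) u
    · have := (AnalyticAt.aeval_mvPolynomial (f := Φ) hu c).continuousAt
      simpa [aeval_eq_eval] using this
    · exact Filter.Eventually.of_forall hcD
  have hstrict : HasStrictFDerivAt Φ (ContinuousLinearMap.pi fun i => fderiv ℂ (φ i) u₀) u₀ :=
    hasStrictFDerivAt_pi.2 fun i => (hu₀ i).hasStrictFDerivAt
  have hsurj : ((ContinuousLinearMap.pi fun i => fderiv ℂ (φ i) u₀ :
      (Fin n → ℂ) →L[ℂ] (Fin n → ℂ)) : (Fin n → ℂ) →ₗ[ℂ] (Fin n → ℂ)).range = ⊤ := by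
    have hM : ((ContinuousLinearMap.pi fun i => fderiv ℂ (φ i) u₀ :
      (Fin n → ℂ) →L[ℂ] (Fin n → ℂ)) : (Fin n → ℂ) →ₗ[ℂ] (Fin n → ℂ))
        = Matrix.toLin' (Matrix.of fun k p => pd (φ k) p u₀) := by
      apply LinearMap.toMatrix'.injective
      ext k p
      rw [LinearMap.toMatrix'_toLin', LinearMap.toMatrix'_apply]
      simp [pd]
    rw [hM, LinearMap.range_eq_top]
    intro y
    refine ⟨(Matrix.of fun k p => pd (φ k) p u₀)⁻¹.mulVec y, ?_⟩
    rw [Matrix.toLin'_apply, Matrix.mulVec_mulVec, Matrix.mul_nonsing_inv _ (isUnit_iff_ne_zero.2 hdet),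
      Matrix.one_mulVec]
  have hmap := hstrict.map_nhds_eq_of_surj hsurj
  have hc0 : ∀ᶠ y in nhds (Φ u₀), eval y c = 0 := by
    rw [← hmap]; exact hnear
  apply MvPolynomial.funext
  intro y
  rw [map_zero]
  refine AnalyticOnNhd.eqOn_zero_of_preconnected_of_eventuallyEq_zero (𝕜 := ℂ) (U := Set.univ)
      (f := fun y => eval y c)
      (fun z _ => ?_) isPreconnected_univ (Set.mem_univ (Φ u₀)) hc0 (Set.mem_univ y)
  have := AnalyticAt.aeval_mvPolynomial (𝕜 := ℂ) (f := fun y : Fin n → ℂ => y) (z := z)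
    (fun i => (ContinuousLinearMap.proj (R := ℂ) (φ := fun _ : Fin n => ℂ) i).analyticAt z) c
  simpa [aeval_eq_eval] using this

/-- Specialising the parameters `y` at points `φ(b)`, with a limit argument for exceptional `b`. -/
lemma specialize_limit {n : ℕ} (φ : Fin n → (Fin n → ℂ) → ℂ)
    (hmero : ∀ k, Mero (φ k)) (hindep : AnalyticallyIndep φ)
    (W : MvPolynomial (Option (Fin n)) (MvPolynomial (Fin n) ℂ)) (hW : W ≠ 0)
    (b : Fin n → ℂ) (hb : ∀ i, AnalyticAt ℂ (φ i) b) :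
    ∃ W' : MvPolynomial (Option (Fin n)) ℂ, W' ≠ 0 ∧ W'.totalDegree ≤ W.totalDegree ∧
      ∀ (x : Fin n → ℂ) (z : (Fin n → ℂ) → ℂ), ContinuousAt z b →
        (∀ᶠ b' in nhds b, eval (fun i => i.elim (z b') x) (map (eval fun i => φ i b') W) = 0) →
        eval (fun i => i.elim (z b) x) W' = 0 := by
  classical
  obtain ⟨m₀, hm₀⟩ := ne_zero_iff.1 hW
  have hfreq := frequently_ne_zero φ hmero hindep (coeff m₀ W) hm₀ b hb
  have hm₀s : m₀ ∈ W.support := mem_support_iff.2 hm₀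
  let S : Set (Fin n → ℂ) := {b' | eval (fun i => φ i b') (coeff m₀ W) ≠ 0}
  haveI : (nhds b ⊓ Filter.principal S).NeBot := Filter.frequently_mem_iff_neBot.1 hfreq
  let 𝓤 : Ultrafilter (Fin n → ℂ) := Ultrafilter.of (nhds b ⊓ Filter.principal S)
  have hU : (𝓤 : Filter (Fin n → ℂ)) ≤ nhds b ⊓ Filter.principal S := Ultrafilter.of_le _
  have hUb : (𝓤 : Filter (Fin n → ℂ)) ≤ nhds b := hU.trans inf_le_left
  have hUS : ∀ᶠ b' in (𝓤 : Filter (Fin n → ℂ)), b' ∈ S :=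
    (hU.trans inf_le_right) (Filter.mem_principal_self S)
  let a : (Fin n → ℂ) → (W.support → ℂ) := fun b' m => eval (fun i => φ i b') (coeff m.1 W)
  let q : (Fin n → ℂ) → (W.support → ℂ) := fun b' => ((‖a b'‖⁻¹ : ℝ) : ℂ) • a b'
  have hqs : ∀ b' ∈ S, q b' ∈ Metric.sphere (0 : W.support → ℂ) 1 := by
    intro b' hb'
    have hne : a b' ≠ 0 := fun h0 => hb' (congrFun h0 ⟨m₀, hm₀s⟩)
    have hn : ‖a b'‖ ≠ 0 := norm_ne_zero_iff.2 hne
    simp only [mem_sphere_iff_norm, sub_zero, q, norm_smul, Complex.norm_real, norm_inv, norm_norm]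
    exact inv_mul_cancel₀ hn
  obtain ⟨w, hw, hlim⟩ := (isCompact_sphere (0 : W.support → ℂ) 1).ultrafilter_le_nhds
    (𝓤.map q) (by
      rw [Filter.le_principal_iff]
      exact Filter.mem_map.2 (hUS.mono hqs))
  have hlim' : Filter.Tendsto q 𝓤 (nhds w) := hlim
  have hw0 : w ≠ 0 := by
    rintro rfl
    simp at hw
  let W' : MvPolynomial (Option (Fin n)) ℂ := ∑ m : W.support, monomial m.1 (w m)
  have hcoeff : ∀ m : W.support, coeff m.1 W' = w m := by
    intro m
    simp only [W', coeff_sum, coeff_monomial]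
    rw [Finset.sum_eq_single m]
    · simp
    · intro m' _ hne
      rw [if_neg (fun h => hne (Subtype.ext h))]
    · simp
  refine ⟨W', ?_, ?_, ?_⟩
  · intro h0
    apply hw0
    funext m
    rw [← hcoeff m, h0]; simp
  · refine (totalDegree_finsetSum_le (d := W.totalDegree) ?_)
    intro m _
    exact (totalDegree_monomial_le _ _).trans (le_totalDegree m.2)
  · intro x z hz hev
    have hE : ∀ y : ℂ, eval (fun i => Option.elim i y x) W'
        = ∑ m : W.support, w m * ∏ i, (Option.elim i y x) ^ m.1 i := by
      intro y
      simp only [W', map_sum, eval_monomial]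
      apply Finset.sum_congr rfl
      intro m _
      rw [Finsupp.prod_fintype _ _ (by simp)]
    rw [hE]
    have ht : Filter.Tendsto (fun b' => ∑ m : W.support, q b' m *
        ∏ i, (Option.elim i (z b') x) ^ m.1 i) 𝓤
        (nhds (∑ m : W.support, w m * ∏ i, (Option.elim i (z b) x) ^ m.1 i)) := by
      apply tendsto_finsetSum
      intro m _
      apply Filter.Tendsto.mul
      · exact (tendsto_pi_nhds.1 hlim') m
      · apply tendsto_finsetProd
        intro i _
        apply Filter.Tendsto.pow
        cases i with
        | none => exact hz.tendsto.mono_left hUb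
        | some i => exact tendsto_const_nhds
    refine tendsto_nhds_unique ht ?_
    refine tendsto_const_nhds.congr' ?_
    filter_upwards [hUb hev] with b' hb'
    have h1 : eval (fun i => Option.elim i (z b') x) (map (eval fun i => φ i b') W)
        = ∑ m : W.support, a b' m * ∏ i, (Option.elim i (z b') x) ^ m.1 i := by
      rw [eval_map, eval₂_eq', ← Finset.sum_coe_sort]
    have h2 : ∑ m : W.support, a b' m * ∏ i, (Option.elim i (z b') x) ^ m.1 i = 0 := by
      rw [← h1]; exact hb'
    simp only [q, Pi.smul_apply, smul_eq_mul, mul_assoc]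
    rw [← Finset.mul_sum, h2, mul_zero]

/-- Regroup variables: `λ, x` outside, `y` in the coefficients. -/
lemma regroup {n : ℕ} (W : MvPolynomial (Option (Fin n ⊕ Fin n)) ℂ) (hW : W ≠ 0) :
    ∃ W' : MvPolynomial (Option (Fin n)) (MvPolynomial (Fin n) ℂ), W' ≠ 0 ∧
      ∀ (z : ℂ) (x y : Fin n → ℂ), eval (fun i => i.elim z x) (map (eval y) W') =
        eval (fun i => i.elim z (Sum.elim x y)) W := by
  let e : Option (Fin n ⊕ Fin n) → Option (Fin n) ⊕ Fin n := fun i =>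
    i.elim (Sum.inl none) (Sum.elim (fun j => Sum.inl (some j)) Sum.inr)
  have he : Function.Injective e := by
    rintro (_ | _ | _) (_ | _ | _) h <;> simp_all [e]
  refine ⟨sumAlgEquiv ℂ _ _ (rename e W), ?_, ?_⟩
  · simp only [ne_eq, EmbeddingLike.map_eq_zero_iff]
    exact fun h => hW (rename_injective e he (by simpa using h))
  · intro z x y
    induction W using MvPolynomial.induction_on with
    | C a => simp
    | add p q hp hq =>
      by_cases h1 : p = 0 <;> by_cases h2 : q = 0 <;> simp_all
    | mul_X p i hp =>
      by_cases h1 : p = 0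
      · simp_all
      · rcases i with _ | _ | _ <;> simp_all [e]

theorem aat_siegel_degree_bound {n : ℕ} (hn : 1 ≤ n) (φ : Fin n → (Fin n → ℂ) → ℂ)
    (hmero : ∀ k, Mero (φ k)) (hindep : AnalyticallyIndep φ) (haat : AdmitsAAT φ)
    (θ : (Fin n → ℂ) → ℂ) (α : Fin n → Fin n → ℂ)
    (hθ : ∀ u, θ u = ∑ k : Fin n, ∑ p : Fin n, α k p * pd (φ k) p u)
    (V : MvPolynomial (Option (Fin n)) ℂ) (hV0 : V ≠ 0)
    (hV : ∀ u, (∀ j, AnalyticAt ℂ (φ j) u) → (∀ j p, AnalyticAt ℂ (pd (φ j) p) u) →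
      eval (tval θ φ u) V = 0)
    (A B : Fin n → Fin n → MvPolynomial (Option (Fin n)) ℂ)
    (hBne : ∀ k p, ∃ u, (∀ j, AnalyticAt ℂ (φ j) u) ∧ (∀ j q, AnalyticAt ℂ (pd (φ j) q) u) ∧
      eval (tval θ φ u) (B k p) ≠ 0)
    (hAB : ∀ k p u, (∀ j, AnalyticAt ℂ (φ j) u) → (∀ j q, AnalyticAt ℂ (pd (φ j) q) u) →
      eval (tval θ φ u) (B k p) ≠ 0 →
      pd (φ k) p u = eval (tval θ φ u) (A k p) / eval (tval θ φ u) (B k p)) :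
    ∃ r : ℕ, ∀ (j : Fin n) (k : ℕ), k ≤ V.degreeOf none →
      ∀ b : Fin n → ℂ, (∀ i, AnalyticAt ℂ (φ i) b) →
      ∃ W : MvPolynomial (Option (Fin n)) ℂ, W ≠ 0 ∧ W.totalDegree ≤ r ∧
        ∀ u : Fin n → ℂ, (∀ i, AnalyticAt ℂ (φ i) u) →
          (∀ i q, AnalyticAt ℂ (pd (φ i) q) u) → AnalyticAt ℂ (φ j) (u + b) →
          eval (fun i => i.elim (φ j (u + b) * θ u ^ (V.degreeOf none - k))
            fun i' => φ i' u) W = 0 := by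
  classical
  choose G hGdeg hG using haat
  have hG0 : ∀ j, G j ≠ 0 := by
    intro j h0
    have := hGdeg j
    rw [h0] at this
    simp at this
  let V' : MvPolynomial (Option (Fin n ⊕ Fin n)) ℂ := rename (Option.map Sum.inl) V
  have hV'0 : V' ≠ 0 := fun h => hV0
    (rename_injective _ (Option.map_injective Sum.inl_injective) (by simpa [V'] using h))
  have hV'e : ∀ (t : ℂ) (x y : Fin n → ℂ), eval (fun i => i.elim t (Sum.elim x y)) V' =
      eval (fun i => i.elim t x) V := by
    intro t x y
    simp only [V', eval_rename]
    congr 2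
    funext i
    cases i <;> rfl
  choose W hW0 hW using fun (j : Fin n) (m : ℕ) => elim_mul_pow (G j) V' (hG0 j) hV'0 m
  choose W' hW'0 hW' using fun (j : Fin n) (m : ℕ) => regroup (W j m) (hW0 j m)
  refine ⟨∑ j : Fin n, ∑ m ∈ Finset.range (V.degreeOf none + 1), (W' j m).totalDegree, ?_⟩
  intro j k hk b hb
  obtain ⟨P, hP0, hPd, hP⟩ := specialize_limit φ hmero hindep (W' j (V.degreeOf none - k))
    (hW'0 _ _) b hb
  refine ⟨P, hP0, hPd.trans ?_, ?_⟩
  · refine le_trans ?_ (Finset.single_le_sum (f := fun j => ∑ m ∈ Finset.range (V.degreeOf none + 1),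
      (W' j m).totalDegree) (fun _ _ => Nat.zero_le _) (Finset.mem_univ j))
    exact Finset.single_le_sum (f := fun m => (W' j m).totalDegree) (fun _ _ => Nat.zero_le _)
      (Finset.mem_range.2 (by omega))
  · intro u hu hdu hub
    have hadd : ContinuousAt (fun b' : Fin n → ℂ => u + b') b := by fun_prop
    apply hP (fun i => φ i u) (fun b' => φ j (u + b') * θ u ^ (V.degreeOf none - k))
    · apply ContinuousAt.mul _ continuousAt_const
      exact ContinuousAt.comp (g := φ j) (f := fun b' => u + b') hub.continuousAt hadd
    · have h1 : ∀ᶠ b' in nhds b, AnalyticAt ℂ (φ j) (u + b') :=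
        hadd.eventually hub.eventually_analyticAt
      have h2 : ∀ᶠ b' in nhds b, ∀ i, AnalyticAt ℂ (φ i) b' :=
        Filter.eventually_all.2 fun i => (hb i).eventually_analyticAt
      filter_upwards [h1, h2] with b' h1 h2
      rw [hW']
      apply hW
      · exact hG j u b' hu h2 h1
      · rw [hV'e]
        exact hV u hu hdu
end

section
/- Suppose the meromorphic mapping Φ = (φ₁,…,φ_n) admits an algebraic addition theorem. Then for every k ∈ {1,…,n} and every fixed b ∈ ℂⁿ at which all φ_j are analytic, the translated function u ↦ φ_k(u+b) is algebraic over ℂ(φ₁,…,φ_n): there exists a nonzero polynomial Q ∈ ℂ[t, x₁,…,x_n], of degree ≥ 1 in t, such that Q(φ_k(u+b); φ₁(u),…,φ_n(u)) = 0 for every u at which each φ_j is analytic and φ_k is analytic at u+b. -/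
open MvPolynomial

open Topology Filter in
lemma ent_freq {n : ℕ} {h : (Fin n → ℂ) → ℂ} (hh : ∀ u, AnalyticAt ℂ h u) (hne : ∃ u, h u ≠ 0)
    (a : Fin n → ℂ) : ∃ᶠ u in 𝓝 a, h u ≠ 0 := by
  intro hc
  obtain ⟨u, hu⟩ := hne
  have hA : AnalyticOnNhd ℂ h Set.univ := fun x _ => hh x
  have hz : AnalyticOnNhd ℂ (fun _ : Fin n → ℂ => (0 : ℂ)) Set.univ := fun x _ => analyticAt_const
  have := hA.eq_of_eventuallyEq hz (z₀ := a) (by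
    filter_upwards [hc] with x hx
    simpa using hx)
  exact hu (congrFun this u)

lemma mero_const {n : ℕ} (c : ℂ) : Mero (fun _ : Fin n → ℂ => c) :=
  ⟨fun _ => c, fun _ => 1, fun _ => analyticAt_const, fun _ => analyticAt_const, ⟨0, one_ne_zero⟩,
    fun _ _ => by simp⟩

lemma ent_mul_ne {n : ℕ} {h k : (Fin n → ℂ) → ℂ} (hh : ∀ u, AnalyticAt ℂ h u)
    (hne : ∃ u, h u ≠ 0) (hk : ∀ u, AnalyticAt ℂ k u)
    (kne : ∃ u, k u ≠ 0) : ∃ u, h u * k u ≠ 0 := by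
  obtain ⟨a, ha⟩ := hne
  have := (ent_freq hk kne a).and_eventually ((hh a).continuousAt.eventually_ne ha)
  obtain ⟨u, h1, h2⟩ := this.exists
  exact ⟨u, mul_ne_zero h2 h1⟩

lemma mero_add {n : ℕ} {f g : (Fin n → ℂ) → ℂ} (hf : Mero f) (hg : Mero g) :
    Mero (fun u => f u + g u) := by
  obtain ⟨a, b, ha, hb, hb0, hab⟩ := hf
  obtain ⟨c, d, hc, hd, hd0, hcd⟩ := hg
  refine ⟨fun u => a u * d u + b u * c u, fun u => b u * d u, fun u => ?_, fun u => ?_,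
    ent_mul_ne hb hb0 hd hd0, fun u hu => ?_⟩
  · exact ((ha u).mul (hd u)).add ((hb u).mul (hc u))
  · exact (hb u).mul (hd u)
  · have h1 := left_ne_zero_of_mul hu
    have h2 := right_ne_zero_of_mul hu
    beta_reduce
    rw [hab u h1, hcd u h2, div_add_div _ _ h1 h2]

lemma mero_mul {n : ℕ} {f g : (Fin n → ℂ) → ℂ} (hf : Mero f) (hg : Mero g) :
    Mero (fun u => f u * g u) := by
  obtain ⟨a, b, ha, hb, hb0, hab⟩ := hf
  obtain ⟨c, d, hc, hd, hd0, hcd⟩ := hg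
  refine ⟨fun u => a u * c u, fun u => b u * d u, fun u => (ha u).mul (hc u),
    fun u => (hb u).mul (hd u), ent_mul_ne hb hb0 hd hd0, fun u hu => ?_⟩
  beta_reduce
  rw [hab u (left_ne_zero_of_mul hu), hcd u (right_ne_zero_of_mul hu), div_mul_div_comm]

lemma mero_poly {n : ℕ} {φ : Fin n → (Fin n → ℂ) → ℂ} (hmero : ∀ k, Mero (φ k))
    (P : MvPolynomial (Fin n) ℂ) : Mero (fun u => eval (fun j => φ j u) P) := by
  induction P using MvPolynomial.induction_on with
  | C a => simpa using mero_const a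
  | add p q hp hq => simpa using mero_add hp hq
  | mul_X p i hp => simpa using mero_mul hp (hmero i)

lemma poly_analytic {E : Type*} [NormedAddCommGroup E] [NormedSpace ℂ E] {n : ℕ}
    {ψ : Fin n → E → ℂ} {a : E} (h : ∀ j, AnalyticAt ℂ (ψ j) a)
    (P : MvPolynomial (Fin n) ℂ) : AnalyticAt ℂ (fun u => eval (fun j => ψ j u) P) a := by
  induction P using MvPolynomial.induction_on with
  | C a => simpa using analyticAt_const
  | add p q hp hq => simpa using! hp.add hq
  | mul_X p i hp => simpa using! hp.mul (h i)

open Topology Filter in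
lemma alg_indep {n : ℕ} {φ : Fin n → (Fin n → ℂ) → ℂ} (hmero : ∀ k, Mero (φ k))
    (hindep : AnalyticallyIndep φ) (P : MvPolynomial (Fin n) ℂ) (a : Fin n → ℂ)
    (h0 : ∀ᶠ u in 𝓝 a, eval (fun j => φ j u) P = 0) : P = 0 := by
  obtain ⟨g, h, hg, hh, hh0, hgh⟩ := mero_poly hmero P
  have hg0 : ∀ u, g u = 0 := by
    by_contra! hne
    have := (ent_freq (fun u => (hg u).mul (hh u)) (ent_mul_ne hg hne hh hh0) a).and_eventually h0
    obtain ⟨u, h1, h2⟩ := this.exists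
    have h3 := hgh u (right_ne_zero_of_mul h1)
    simp only at h3
    rw [h2] at h3
    exact div_ne_zero (left_ne_zero_of_mul h1) (right_ne_zero_of_mul h1) h3.symm
  obtain ⟨u0, hu0, hdet⟩ := hindep
  have hloc : ∀ᶠ u in 𝓝 u0, eval (fun j => φ j u) P = 0 := by
    have han : ∀ᶠ u in 𝓝 u0, ∀ j, AnalyticAt ℂ (φ j) u :=
      eventually_all.2 fun j => (hu0 j).eventually_analyticAt
    filter_upwards [han] with u hu
    by_contra hne
    have hc := (poly_analytic hu P).continuousAt.eventually_ne hne
    obtain ⟨w, h1, h2⟩ := ((ent_freq hh hh0 u).and_eventually hc).exists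
    apply h2
    have := hgh w h1
    simpa [hg0 w] using this
  -- inverse function theorem
  let F : (Fin n → ℂ) → (Fin n → ℂ) := fun u j => φ j u
  let D : (Fin n → ℂ) →L[ℂ] (Fin n → ℂ) := ContinuousLinearMap.pi fun j => fderiv ℂ (φ j) u0
  have hD : HasStrictFDerivAt F D u0 :=
    hasStrictFDerivAt_pi.2 fun j => (hu0 j).hasStrictFDerivAt
  have hDm : LinearMap.toMatrix' (D : (Fin n → ℂ) →ₗ[ℂ] (Fin n → ℂ)) =
      Matrix.of fun k p => pd (φ k) p u0 := by
    ext i j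
    simp [LinearMap.toMatrix'_apply, D, pd]
  have hsurj : D.range = ⊤ := by
    have hu : IsUnit (LinearMap.det (D : (Fin n → ℂ) →ₗ[ℂ] (Fin n → ℂ))) := by
      rw [← LinearMap.det_toMatrix', hDm]
      exact isUnit_iff_ne_zero.2 hdet
    exact LinearMap.range_eq_top.2 (LinearEquiv.ofIsUnitDet (f := (D : (Fin n → ℂ) →ₗ[ℂ] (Fin n → ℂ))) (v := Pi.basisFun ℂ _) (v' := Pi.basisFun ℂ _) (by
        rw [← LinearMap.toMatrix_eq_toMatrix'] at hDm
        rw [hDm]; exact isUnit_iff_ne_zero.2 hdet)).surjective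
  have hmap := hD.map_nhds_eq_of_surj hsurj
  have hP : ∀ᶠ x in 𝓝 (F u0), eval x P = 0 := by
    rw [← hmap]
    exact hloc
  apply MvPolynomial.funext
  intro x
  by_contra hne
  have hent : ∀ u : Fin n → ℂ, AnalyticAt ℂ (fun u => eval u P) u := fun u =>
    poly_analytic (ψ := fun j (u : Fin n → ℂ) => u j)
      (fun j => (ContinuousLinearMap.proj (R := ℂ) (φ := fun _ : Fin n => ℂ) j).analyticAt u) P
  obtain ⟨y, h1, h2⟩ := ((ent_freq hent ⟨x, by simpa using hne⟩ (F u0)).and_eventually hP).exists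
  exact h1 h2

open Topology Filter in
/-- Specialisation of a polynomial family along a line through `b`. -/
lemma specialise {n : ℕ} {φ : Fin n → (Fin n → ℂ) → ℂ} (hmero : ∀ k, Mero (φ k))
    (hindep : AnalyticallyIndep φ) (b : Fin n → ℂ) (hb : ∀ j, AnalyticAt ℂ (φ j) b)
    (G : MvPolynomial (Option (Fin n)) (MvPolynomial (Fin n) ℂ)) (hG : G ≠ 0) :
    ∃ w : Fin n → ℂ, ∃ Q : MvPolynomial (Option (Fin n)) ℂ, Q ≠ 0 ∧
      ∀ x : ℂ → Option (Fin n) → ℂ, ContinuousAt x 0 →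
        (∀ᶠ t in 𝓝 (0 : ℂ), eval (x t) (map (eval fun j => φ j (b + t • w)) G) = 0) →
        eval (x 0) Q = 0 := by
  obtain ⟨m0, hm0⟩ := MvPolynomial.ne_zero_iff.1 hG
  have han : ∀ᶠ u in 𝓝 b, ∀ j, AnalyticAt ℂ (φ j) u :=
    eventually_all.2 fun j => (hb j).eventually_analyticAt
  obtain ⟨r, hr, hball⟩ := Metric.eventually_nhds_iff_ball.1 han
  have hfr : ∃ᶠ u in 𝓝 b, eval (fun j => φ j u) (coeff m0 G) ≠ 0 := fun hc =>
    hm0 (alg_indep hmero hindep _ b (by simpa using hc))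
  obtain ⟨v, hv, hvb⟩ := (hfr.and_eventually (Metric.ball_mem_nhds b hr)).exists
  have hline : ∀ w : Fin n → ℂ, ∀ t : ℂ, AnalyticAt ℂ (fun t : ℂ => b + t • w) t := fun w t => by
    fun_prop
  let S : Set ℂ := (fun t : ℂ => b + t • (v - b)) ⁻¹' Metric.ball b r
  have hSc : Convex ℝ S := by
    have : S = ((LinearMap.toSpanSingleton ℂ (Fin n → ℂ) (v - b)).restrictScalars ℝ) ⁻¹'
        ((fun z => b + z) ⁻¹' Metric.ball b r) := rfl
    rw [this]
    exact ((convex_ball b r).translate_preimage_right b).linear_preimage _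
  have hS0 : (0 : ℂ) ∈ S := by simp [S, hr]
  have hS1 : (1 : ℂ) ∈ S := by simpa [S] using hvb
  let f : ℂ → (G.support → ℂ) := fun t m => eval (fun j => φ j (b + t • (v - b))) (coeff m.1 G)
  have hfa : ∀ t ∈ S, ∀ m, AnalyticAt ℂ
      (fun t : ℂ => eval (fun j => φ j (b + t • (v - b))) (coeff m G)) t := fun t ht m =>
    poly_analytic (ψ := fun j (t : ℂ) => φ j (b + t • (v - b)))
      (fun j => AnalyticAt.comp (g := φ j) (f := fun t : ℂ => b + t • (v - b)) (hball _ ht j) (hline (v - b) t)) _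
  have hf0 : AnalyticAt ℂ f 0 := AnalyticAt.pi fun m => hfa 0 hS0 m.1
  have hne : ¬ ∀ᶠ t in 𝓝 (0 : ℂ), f t = 0 := by
    intro hc
    have hA : AnalyticOnNhd ℂ
      (fun t : ℂ => eval (fun j => φ j (b + t • (v - b))) (coeff m0 G)) S := fun t ht => hfa t ht m0
    have hz := hA.eqOn_zero_of_preconnected_of_eventuallyEq_zero hSc.isPreconnected hS0 (by
      filter_upwards [hc] with t ht
      exact congrFun ht ⟨m0, MvPolynomial.mem_support_iff.2 hm0⟩)
    have := hz hS1
    apply hv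
    simpa using this
  obtain ⟨N, g, hg, hg0, hfg⟩ := hf0.exists_eventuallyEq_pow_smul_nonzero_iff.2 hne
  refine ⟨v - b, ∑ m : G.support, monomial m.1 (g 0 m), ?_, ?_⟩
  · intro hQ
    apply hg0
    ext m
    have := congrArg (coeff m.1) hQ
    simpa [coeff_sum, coeff_monomial, Subtype.val_inj] using this
  · intro x hx hev
    let E : ℂ → ℂ := fun t => ∑ m : G.support, g t m * m.1.prod fun i e => x t i ^ e
    have hE0 : eval (x 0) (∑ m : G.support, monomial m.1 (g 0 m)) = E 0 := by
      simp [E, eval_monomial]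
    rw [hE0]
    have hEc : ContinuousAt E 0 := by
      have hgc := continuousAt_pi.1 hg.continuousAt
      have hxc := continuousAt_pi.1 hx
      refine tendsto_finsetSum _ fun m _ => (hgc m).mul ?_
      exact tendsto_finsetProd _ fun i _ => (hxc i).pow _
    have hEz : ∀ᶠ t in 𝓝[≠] (0 : ℂ), E t = 0 := by
      filter_upwards [hev.filter_mono nhdsWithin_le_nhds, hfg.filter_mono nhdsWithin_le_nhds,
        self_mem_nhdsWithin] with t h1 h2 h3
      have h4 : t ^ N * E t = 0 := by
        rw [← h1, eval_map, eval₂_eq', ← Finset.sum_coe_sort, Finset.mul_sum]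
        refine Finset.sum_congr rfl fun m _ => ?_
        have := congrFun h2 m
        simp only [f, sub_zero, Pi.smul_apply, smul_eq_mul] at this
        rw [this, Finsupp.prod_fintype _ _ (by simp)]
        ring
      exact (mul_eq_zero.1 h4).resolve_left (pow_ne_zero _ h3)
    have hl : Tendsto E (𝓝[≠] 0) (𝓝 0) := tendsto_const_nhds.congr' (by
      filter_upwards [hEz] with t ht using ht.symm)
    exact tendsto_nhds_unique (hEc.tendsto.mono_left nhdsWithin_le_nhds) hl

theorem aat_translate_algebraic {n : ℕ} (hn : 1 ≤ n) (φ : Fin n → (Fin n → ℂ) → ℂ)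
    (hmero : ∀ k, Mero (φ k)) (hindep : AnalyticallyIndep φ) (haat : AdmitsAAT φ)
    (k : Fin n) (b : Fin n → ℂ) (hb : ∀ j, AnalyticAt ℂ (φ j) b) :
    ∃ Q : MvPolynomial (Option (Fin n)) ℂ, Q ≠ 0 ∧ 1 ≤ Q.degreeOf none ∧
      ∀ u : Fin n → ℂ, (∀ j, AnalyticAt ℂ (φ j) u) → AnalyticAt ℂ (φ k) (u + b) →
        eval (fun i => i.elim (φ k (u + b)) fun j => φ j u) Q = 0 := by
  obtain ⟨G, hGd, hG⟩ := haat k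
  -- regroup the variables
  let σ : Option (Fin n ⊕ Fin n) ≃ Option (Fin n) ⊕ Fin n :=
    { toFun := fun i => i.elim (Sum.inl none) (Sum.elim (fun j => Sum.inl (some j)) Sum.inr)
      invFun := Sum.elim (fun i => i.elim none fun j => some (Sum.inl j)) fun j => some (Sum.inr j)
      left_inv := by rintro (_ | _ | _) <;> rfl
      right_inv := by rintro ((_ | _) | _) <;> rfl }
  let G' := sumAlgEquiv ℂ (Option (Fin n)) (Fin n) (rename σ G)
  have hG'0 : G' ≠ 0 := by
    intro h
    have h1 : rename σ G = 0 := (sumAlgEquiv ℂ (Option (Fin n)) (Fin n)).injective (by simpa [G'] using h)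
    have h2 : G = 0 := rename_injective σ σ.injective (by simpa using h1)
    simp [h2] at hGd
  have hG'e : ∀ (x : Option (Fin n) → ℂ) (y : Fin n → ℂ), eval x (map (eval y) G') =
      eval (fun i => i.elim (x none) (Sum.elim (fun j => x (some j)) y)) G := by
    intro x y
    simp only [G']
    clear hGd hG G' hG'0
    induction G using MvPolynomial.induction_on with
    | C a => simp
    | add p q hp hq => simp [hp, hq]
    | mul_X p i hp =>
      simp only [map_mul, hp]
      congr 1
      rcases i with _ | _ | _ <;> simp [σ]
  obtain ⟨w, Q, hQ0, hQ⟩ := specialise hmero hindep b hb G' hG'0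
  have han : ∀ᶠ u in nhds b, ∀ j, AnalyticAt ℂ (φ j) u :=
    Filter.eventually_all.2 fun j => (hb j).eventually_analyticAt
  have hl : ∀ a : Fin n → ℂ, Filter.Tendsto (fun t : ℂ => a + t • w) (nhds 0) (nhds a) := fun a => by
    have : ContinuousAt (fun t : ℂ => a + t • w) 0 := by fun_prop
    simpa [ContinuousAt] using this
  have key : ∀ u : Fin n → ℂ, (∀ j, AnalyticAt ℂ (φ j) u) → AnalyticAt ℂ (φ k) (u + b) →
        eval (fun i => i.elim (φ k (u + b)) fun j => φ j u) Q = 0 := by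
    intro u hu hub
    have := hQ (fun t i => i.elim (φ k (u + b + t • w)) fun j => φ j u) ?_ ?_
    · simpa using this
    · refine continuousAt_pi.2 fun i => ?_
      rcases i with _ | j
      · have h1 := hub.continuousAt.tendsto.comp (hl (u + b))
        simpa [ContinuousAt, Function.comp_def] using h1
      · exact continuousAt_const
    · filter_upwards [(hl b).eventually han, (hl (u + b)).eventually hub.eventually_analyticAt]
        with t h1 h2
      rw [hG'e]
      have := hG u (b + t • w) hu h1 (by rwa [← add_assoc])
      rw [← add_assoc] at this
      exact this
  refine ⟨Q, hQ0, ?_, key⟩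
  by_contra hdeg
  have hdeg0 : Q.degreeOf none = 0 := by omega
  obtain ⟨P, rfl⟩ : ∃ P : MvPolynomial (Fin n) ℂ, rename some P = Q := by
    apply exists_rename_eq_of_vars_subset_range Q some (Option.some_injective _)
    intro i hi
    rcases i with _ | j
    · exact absurd hdeg0 (mem_vars_iff_degreeOf_ne_zero.1 (Finset.mem_coe.1 hi))
    · exact ⟨j, rfl⟩
  obtain ⟨u0, hu0, -⟩ := id hindep
  obtain ⟨g, h, hg, hh, hh0, hgh⟩ := hmero k
  have hfr := ent_freq hh hh0 (u0 + b)
  have hcont : ∀ᶠ z in nhds (u0 + b), ∀ j, AnalyticAt ℂ (φ j) (z - b) := by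
    have ht : Filter.Tendsto (fun z => z - b) (nhds (u0 + b)) (nhds u0) := by
      have : ContinuousAt (fun z : Fin n → ℂ => z - b) (u0 + b) := by fun_prop
      simpa [ContinuousAt] using this
    exact ht.eventually (Filter.eventually_all.2 fun j => (hu0 j).eventually_analyticAt)
  obtain ⟨z, hz1, hz2⟩ := (hfr.and_eventually hcont).exists
  have hka : AnalyticAt ℂ (φ k) z := by
    refine ((hg z).div (hh z) hz1).congr ?_
    filter_upwards [(hh z).continuousAt.eventually_ne hz1] with y hy
    simpa using (hgh y hy).symm
  have hev : ∀ᶠ u in nhds (z - b), AnalyticAt ℂ (φ k) (u + b) := by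
    have ht : Filter.Tendsto (fun u => u + b) (nhds (z - b)) (nhds z) := by
      have : ContinuousAt (fun z : Fin n → ℂ => z + b) (z - b) := by fun_prop
      simpa [ContinuousAt] using this
    exact ht.eventually hka.eventually_analyticAt
  have hP : P = 0 := by
    refine alg_indep hmero hindep P (z - b) ?_
    filter_upwards [hev, Filter.eventually_all.2 fun j => (hz2 j).eventually_analyticAt] with u h1 h2
    have := key u h2 h1
    rw [eval_rename] at this
    exact this
  exact hQ0 (by simp [hP])
end
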